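/- arXiv:1903.02317 — 3 statements merged into one kernel-verified Lean document; each statement's English description precedes it below -/
import Mathlib

section
/- Let 𝒯 be a family of distinct 3-sets with |U(𝒯)| = n ≥ 4 and |𝒯| ≥ 2n/3 + 1 (equivalently 3·|𝒯| ≥ 2n + 3). Then every union-closed family 𝔉 with 𝒯 ⊆ 𝔉 satisfies Frankl's conjecture: there exists i ∈ U(𝔉) with 2·|𝔉_i| ≥ |𝔉|. -/
/-- A family of sets is union-closed. -/
def UC (F : Finset (Finset ℕ)) : Prop := ∀ A ∈ F, ∀ B ∈ F, A ∪ B ∈ F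

/-- `famU F` is the union `U(F)` of all members of the family `F`. -/
def famU (F : Finset (Finset ℕ)) : Finset ℕ := F.sup id

/-- `memFam F i` is the subfamily `F_i` of sets in `F` containing `i`. -/
def memFam (F : Finset (Finset ℕ)) (i : ℕ) : Finset (Finset ℕ) :=
  F.filter (fun S => i ∈ S)

/-!
Subsets of a list `vs` of labels are encoded by bit masks. A *certificate* is a binary tree of case
distinctions `A ∈ K` / `A ∉ K` on a union-closed family `K` of masks; at its leaves a greedy
transport of weight along injections `S ∈ K → S ||| g ∈ K` shows that the average weight of the
members of `K` is at least half of the total weight.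
-/

namespace Frankl

/-- Apply `f` to `n`, after the kernel has evaluated `n` to a literal. -/
def force {α : Type} (n : ℕ) (f : ℕ → α) : α :=
  match n with
  | 0 => f 0
  | k + 1 => f (Nat.succ k)

theorem force_eq {α : Type} (n : ℕ) (f : ℕ → α) : force n f = f n := by
  cases n <;> rfl

/-- Apply `f` to `l`, after the kernel has evaluated all entries of `l` to literals. -/
def forceList {α : Type} : List ℕ → (List ℕ → α) → α
  | [], f => f []
  | a :: l, f => force a fun a => forceList l fun l => f (a :: l)

theorem forceList_eq {α : Type} (l : List ℕ) (f : List ℕ → α) : forceList l f = f l := by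
  induction l generalizing f with
  | nil => rfl
  | cons a l ih => simp [forceList, force_eq, ih]

/-- A natural-number capacity for every bit mask of a fixed length, least significant bit first. -/
inductive CapTree
  | leaf (c : ℕ)
  | node (l r : CapTree)

namespace CapTree

/-- The total capacity, weighted by `x`. -/
def dot : CapTree → (ℕ → ℕ) → ℕ
  | leaf c, x => c * x 0
  | node l r, x => dot l (fun S => x (2 * S)) + dot r (fun S => x (2 * S + 1))

/-- Withdraw at most `want` from the capacity of `S`, and continue with the unmet part of the
demand and the remaining capacities. -/
def withdraw : CapTree → ℕ → ℕ → (ℕ → CapTree → Bool) → Bool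
  | leaf c, want, S, k =>
    bif S.beq 0 then
      force (want - c) fun want' => force (c - want) fun c' => k want' (leaf c')
    else k want (leaf c)
  | node l r, want, S, k =>
    bif (S % 2).beq 0 then withdraw l want (S / 2) fun want' l' => k want' (node l' r)
    else withdraw r want (S / 2) fun want' r' => k want' (node l r')

theorem withdraw_spec (t : CapTree) (want S : ℕ) (k : ℕ → CapTree → Bool)
    (h : t.withdraw want S k = true) :
    ∃ want' t', k want' t' = true ∧ want' ≤ want ∧
      ∀ x : ℕ → ℕ, t'.dot x + want * x S ≤ t.dot x + want' * x S := by
  induction t generalizing S k with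
  | leaf c =>
    simp only [withdraw, force_eq, cond_eq_ite, Nat.beq_eq] at h
    split_ifs at h with hS
    · refine ⟨_, _, h, Nat.sub_le _ _, fun x => ?_⟩
      subst hS
      simp only [dot, ← add_mul]
      exact Nat.mul_le_mul_right _ (by omega)
    · exact ⟨_, _, h, le_rfl, fun x => le_rfl⟩
  | node l r ihl ihr =>
    simp only [withdraw, cond_eq_ite, Nat.beq_eq] at h
    split_ifs at h with hS
    · obtain ⟨w', l', hk, hw, hx⟩ := ihl _ _ h
      refine ⟨_, _, hk, hw, fun x => ?_⟩
      have := hx fun S => x (2 * S)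
      rw [show 2 * (S / 2) = S by omega] at this
      simp only [dot]
      omega
    · obtain ⟨w', r', hk, hw, hx⟩ := ihr _ _ h
      refine ⟨_, _, hk, hw, fun x => ?_⟩
      have := hx fun S => x (2 * S + 1)
      rw [show 2 * (S / 2) + 1 = S by omega] at this
      simp only [dot]
      omega

/-- Withdraw a total of `want` from the masks in a list, in this order, as far as possible. -/
def withdrawList : List ℕ → ℕ → CapTree → (CapTree → Bool) → Bool
  | [], want, t, k => bif want.beq 0 then k t else false
  | u :: us, want, t, k =>
    bif want.beq 0 then k t
    else force u fun u => t.withdraw want u fun want' t' => withdrawList us want' t' k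

theorem withdrawList_spec (us : List ℕ) (want : ℕ) (t : CapTree) (k : CapTree → Bool)
    (h : withdrawList us want t k = true) :
    ∃ t', k t' = true ∧ ∀ (x : ℕ → ℕ) (y : ℕ), (∀ u ∈ us, y ≤ x u) →
      t'.dot x + want * y ≤ t.dot x := by
  induction us generalizing want t with
  | nil =>
    simp only [withdrawList, cond_eq_ite, Nat.beq_eq] at h
    split_ifs at h with hw
    exact ⟨t, h, by simp [hw]⟩
  | cons u us ih =>
    simp only [withdrawList, force_eq, cond_eq_ite, Nat.beq_eq] at h
    split_ifs at h with hw
    · exact ⟨t, h, by simp [hw]⟩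
    · obtain ⟨w', t', hk, hle, hx⟩ := withdraw_spec _ _ _ _ h
      obtain ⟨t'', hk', hx'⟩ := ih _ _ hk
      refine ⟨t'', hk', fun x y hy => ?_⟩
      have h1 := hx x
      have h2 := hx' x y fun v hv => hy v (List.mem_cons_of_mem _ hv)
      have h3 := hy u List.mem_cons_self
      obtain ⟨d, rfl⟩ := Nat.exists_eq_add_of_le hle
      have := Nat.mul_le_mul_left d h3
      linarith [add_mul w' d y, add_mul w' d (x u)]

end CapTree

/-- The total weight of a bit mask. -/
def weight : List ℕ → ℕ → ℕ
  | [], _ => 0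
  | a :: ws, S => bif (S % 2).beq 0 then weight ws (S / 2) else a + weight ws (S / 2)

/-- Apply `k` to the tree in which each mask `S` has capacity `2 * (acc + weight ws S) - W`. -/
def withSurplus (W : ℕ) : List ℕ → ℕ → (CapTree → Bool) → Bool
  | [], acc, k => force (2 * acc - W) fun c => k (.leaf c)
  | a :: ws, acc, k =>
    force (acc + a) fun acc' =>
      withSurplus W ws acc fun l => withSurplus W ws acc' fun r => k (.node l r)

/-- Apply `k` to the list of the pairs `(S, W - 2 * weight ws S)` with positive second entry. -/
def withDeficits (W : ℕ) (ws : List ℕ) : List ℕ → (List (ℕ × ℕ) → Bool) → Bool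
  | [], k => k []
  | S :: l, k =>
    force S fun S => force (W - 2 * weight ws S) fun d =>
      withDeficits W ws l fun ds => bif d.beq 0 then k ds else k ((S, d) :: ds)

theorem sum_range_two_mul (n : ℕ) (f : ℕ → ℕ) :
    ∑ S ∈ Finset.range (2 * n), f S = ∑ S ∈ Finset.range n, (f (2 * S) + f (2 * S + 1)) := by
  induction n with
  | zero => simp
  | succ n ih =>
    rw [Finset.sum_range_succ, ← ih, show 2 * (n + 1) = 2 * n + 1 + 1 by ring,
      Finset.sum_range_succ, Finset.sum_range_succ, add_assoc]

theorem weight_two_mul (a : ℕ) (ws : List ℕ) (S : ℕ) :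
    weight (a :: ws) (2 * S) = weight ws S := by
  simp [weight]

theorem weight_two_mul_add_one (a : ℕ) (ws : List ℕ) (S : ℕ) :
    weight (a :: ws) (2 * S + 1) = a + weight ws S := by
  have h1 : (2 * S + 1) % 2 = 1 := by omega
  have h2 : (2 * S + 1) / 2 = S := by omega
  simp only [weight, h1, h2]
  rfl

theorem withSurplus_spec {W : ℕ} {ws : List ℕ} {acc : ℕ} {k : CapTree → Bool}
    (h : withSurplus W ws acc k = true) :
    ∃ t, k t = true ∧ ∀ x : ℕ → ℕ, t.dot x =
      ∑ S ∈ Finset.range (2 ^ ws.length), (2 * (acc + weight ws S) - W) * x S := by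
  induction ws generalizing acc k with
  | nil =>
    simp only [withSurplus, force_eq] at h
    exact ⟨_, h, by simp [CapTree.dot, weight]⟩
  | cons a ws ih =>
    simp only [withSurplus, force_eq] at h
    obtain ⟨l, hl, hlx⟩ := ih h
    obtain ⟨r, hr, hrx⟩ := ih hl
    refine ⟨_, hr, fun x => ?_⟩
    rw [List.length_cons, pow_succ', sum_range_two_mul, Finset.sum_add_distrib]
    simp only [CapTree.dot, hlx, hrx, weight_two_mul, weight_two_mul_add_one, add_assoc]

theorem withDeficits_spec {W : ℕ} {ws l : List ℕ} {k : List (ℕ × ℕ) → Bool}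
    (h : withDeficits W ws l k = true) :
    ∃ ds, k ds = true ∧ ∀ x : ℕ → ℕ, (ds.map fun p => p.2 * x p.1).sum =
      (l.map fun S => (W - 2 * weight ws S) * x S).sum := by
  induction l generalizing k with
  | nil => exact ⟨_, h, by simp⟩
  | cons S l ih =>
    simp only [withDeficits, force_eq] at h
    obtain ⟨ds, hds, hx⟩ := ih h
    simp only [cond_eq_ite, Nat.beq_eq] at hds
    split_ifs at hds with hS
    · exact ⟨_, hds, fun x => by simp [hx, hS]⟩
    · exact ⟨_, hds, fun x => by simp [hx]⟩

/-- Whether `S` is known not to lie in a family that is closed under union with each of `gens` and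
contains none of `E`. -/
def excluded (gens E : List ℕ) (S : ℕ) : Bool :=
  E.any fun e => (S ||| e).beq e && (S.beq e || gens.any fun g => (S ||| g).beq e)

/-- Greedily cover the deficits in a list by the capacities in a tree. -/
def settle (gens M E : List ℕ) : List (ℕ × ℕ) → CapTree → Bool
  | [], _ => true
  | (S, d) :: ds, t =>
    bif excluded gens E S then settle gens M E ds t
    else CapTree.withdrawList (gens.map (S ||| ·) ++ M) d t fun t' => settle gens M E ds t'

/-- Insertion into a strictly increasing list. -/
def insertMask (a : ℕ) : List ℕ → List ℕ
  | [] => [a]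
  | b :: l => bif a.beq b then b :: l else bif a.ble b then a :: b :: l else b :: insertMask a l

theorem mem_insertMask {a b : ℕ} {l : List ℕ} (h : b ∈ insertMask a l) : b = a ∨ b ∈ l := by
  induction l with
  | nil => simpa [insertMask] using h
  | cons c l ih =>
    simp only [insertMask, cond_eq_ite, Nat.beq_eq] at h
    split_ifs at h <;> simp_all only [List.mem_cons] <;> tauto

/-- Insert `A` and its unions with the masks in `gens`. -/
def adjoin (A : ℕ) (gens l : List ℕ) : List ℕ :=
  (A :: gens.map (A ||| ·)).foldr insertMask l

/-- A tree of case distinctions on whether a mask lies in the family. -/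
inductive Cert
  | leaf
  | branch (A : ℕ) (mem notMem : Cert)

/-- Check that the deficits `ds` are covered by the capacities `t` in every family of masks that is
closed under union, is closed under union with each of `gens`, contains all of `M` and contains none
of `E`. -/
def Cert.check (ds : List (ℕ × ℕ)) (t : CapTree) : Cert → (gens M E : List ℕ) → Bool
  | leaf, gens, M, E => M.any (excluded gens E) || settle gens M E ds t
  | branch A mem notMem, gens, M, E =>
    (forceList (adjoin A gens gens) fun gens' => forceList (adjoin A gens M) fun M' =>
      mem.check ds t gens' M' E) && notMem.check ds t gens M (A :: E)

/-- Check a certificate for the families that are closed under union with each of the masks `T`. -/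
def Cert.verify (W : ℕ) (ws T : List ℕ) (c : Cert) : Bool :=
  withSurplus W ws 0 fun t => withDeficits W ws (List.range (2 ^ ws.length)) fun ds =>
    forceList (T.foldr (fun A gens => adjoin A gens gens) []) fun gens => c.check ds t gens [] []

theorem mem_adjoin {A b : ℕ} {gens l : List ℕ} (h : b ∈ adjoin A gens l) :
    b = A ∨ (∃ g ∈ gens, b = A ||| g) ∨ b ∈ l := by
  have key : ∀ l' : List ℕ, b ∈ l'.foldr insertMask l → b ∈ l' ∨ b ∈ l := by
    intro l' h
    induction l' with
    | nil => exact Or.inr h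
    | cons c l' ih =>
      rcases mem_insertMask h with rfl | h
      · simp
      · rcases ih h with h | h <;> simp [h]
  have := key _ h
  simpa only [List.mem_cons, List.mem_map, or_assoc, @eq_comm _ _ b] using this

section Soundness

variable {P : ℕ → Prop} {gens M E : List ℕ}

theorem not_of_excluded (hgens : ∀ g ∈ gens, ∀ S, P S → P (S ||| g)) (hE : ∀ e ∈ E, ¬ P e) {S : ℕ}
    (h : excluded gens E S = true) : ¬ P S := by
  intro hS
  simp only [excluded, List.any_eq_true, Bool.or_eq_true, Bool.and_eq_true, Nat.beq_eq] at h
  obtain ⟨e, he, -, rfl | ⟨g, hg, rfl⟩⟩ := h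
  · exact hE _ he hS
  · exact hE _ he (hgens g hg S hS)

variable [DecidablePred P]

theorem settle_sound (hgens : ∀ g ∈ gens, ∀ S, P S → P (S ||| g)) (hM : ∀ a ∈ M, P a)
    (hE : ∀ e ∈ E, ¬ P e) (ds : List (ℕ × ℕ)) (t : CapTree) (h : settle gens M E ds t = true) :
    (ds.map fun p => p.2 * if P p.1 then 1 else 0).sum ≤ t.dot fun S => if P S then 1 else 0 := by
  induction ds generalizing t with
  | nil => simp
  | cons p ds ih =>
    obtain ⟨S, d⟩ := p
    simp only [settle, cond_eq_ite] at h
    rw [List.map_cons, List.sum_cons]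
    split_ifs at h with hS
    · simpa [not_of_excluded hgens hE hS] using ih t h
    · obtain ⟨t', hk, ht⟩ := CapTree.withdrawList_spec _ _ _ _ h
      have h1 := ih t' hk
      have h2 := ht (fun S => if P S then 1 else 0) (if P S then 1 else 0) (by
        intro u hu
        split_ifs with hPS hPu <;> try simp
        rw [List.mem_append, List.mem_map] at hu
        rcases hu with ⟨g, hg, rfl⟩ | hu
        · exact hPu (hgens g hg S hPS)
        · exact hPu (hM u hu))
      dsimp only at h2 ⊢
      omega

theorem Cert.check_sound {ds : List (ℕ × ℕ)} {t : CapTree} (c : Cert)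
    (hP : ∀ A B, P A → P B → P (A ||| B)) (hgens : ∀ g ∈ gens, ∀ S, P S → P (S ||| g))
    (hM : ∀ a ∈ M, P a) (hE : ∀ e ∈ E, ¬ P e) (h : c.check ds t gens M E = true) :
    (ds.map fun p => p.2 * if P p.1 then 1 else 0).sum ≤ t.dot fun S => if P S then 1 else 0 := by
  induction c generalizing gens M E with
  | leaf =>
    simp only [check, Bool.or_eq_true, List.any_eq_true] at h
    rcases h with ⟨a, ha, h⟩ | h
    · exact absurd (hM a ha) (not_of_excluded hgens hE h)
    · exact settle_sound hgens hM hE _ _ h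
  | branch A mem notMem ihm ihn =>
    simp only [check, forceList_eq, Bool.and_eq_true] at h
    by_cases hA : P A
    · refine ihm (fun g hg S hS => ?_) (fun a ha => ?_) hE h.1
      · rcases mem_adjoin hg with rfl | ⟨g', hg', rfl⟩ | hg
        · exact hP _ _ hS hA
        · exact hP _ _ hS (hgens g' hg' A hA)
        · exact hgens g hg S hS
      · rcases mem_adjoin ha with rfl | ⟨g', hg', rfl⟩ | ha
        · exact hA
        · exact hgens g' hg' A hA
        · exact hM a ha
    · refine ihn hgens hM (fun e he => ?_) h.2
      rcases List.mem_cons.1 he with rfl | he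
      · exact hA
      · exact hE e he

theorem Cert.verify_sound {W : ℕ} {ws T : List ℕ} (c : Cert) (hP : ∀ A B, P A → P B → P (A ||| B))
    (hT : ∀ g ∈ T, ∀ S, P S → P (S ||| g)) (h : c.verify W ws T = true) :
    ∑ S ∈ Finset.range (2 ^ ws.length), (W - 2 * weight ws S) * (if P S then 1 else 0) ≤
      ∑ S ∈ Finset.range (2 ^ ws.length), (2 * weight ws S - W) * if P S then 1 else 0 := by
  obtain ⟨t, h₁, ht⟩ := withSurplus_spec h
  obtain ⟨ds, h₂, hds⟩ := withDeficits_spec h₁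
  rw [forceList_eq] at h₂
  have hgens : ∀ g ∈ T.foldr (fun A gens => adjoin A gens gens) [], ∀ S, P S → P (S ||| g) := by
    clear h h₁ h₂
    induction T with
    | nil => simp
    | cons A T ih =>
      have ih := ih fun g hg => hT g (List.mem_cons_of_mem _ hg)
      have hA := hT A List.mem_cons_self
      intro g hg S hS
      rcases mem_adjoin hg with rfl | ⟨g', hg', rfl⟩ | hg
      · exact hA S hS
      · rw [← Nat.lor_assoc]
        exact ih g' hg' _ (hA S hS)
      · exact ih g hg S hS
  have := c.check_sound hP hgens (by simp) (by simp) h₂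
  rw [ht, hds fun S => if P S then 1 else 0] at this
  simpa [Finset.sum, Finset.range, Multiset.range] using this

end Soundness

section Decode

/-- The set of labels in `vs` selected by a bit mask. -/
def decode : List ℕ → ℕ → Finset ℕ
  | [], _ => ∅
  | v :: vs, S => if S % 2 = 1 then insert v (decode vs (S / 2)) else decode vs (S / 2)

theorem decode_lor (vs : List ℕ) (S S' : ℕ) :
    decode vs (S ||| S') = decode vs S ∪ decode vs S' := by
  induction vs generalizing S S' with
  | nil => simp [decode]
  | cons v vs ih =>
    simp only [decode, Nat.or_div_two, ih, Nat.or_mod_two_eq_one]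
    by_cases h : S % 2 = 1 <;> by_cases h' : S' % 2 = 1 <;>
      simp only [h, h', if_true, if_false, or_true, true_or, or_self] <;> ext <;> simp

theorem decode_subset (vs : List ℕ) (S : ℕ) : decode vs S ⊆ vs.toFinset := by
  induction vs generalizing S with
  | nil => simp [decode]
  | cons v vs ih =>
    rw [decode, List.toFinset_cons]
    split_ifs
    · exact Finset.insert_subset_insert _ (ih _)
    · exact (ih _).trans (Finset.subset_insert _ _)

theorem decode_cons_two_mul (v : ℕ) (vs : List ℕ) (S : ℕ) :
    decode (v :: vs) (2 * S) = decode vs S := by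
  simp [decode]

theorem decode_cons_two_mul_add_one (v : ℕ) (vs : List ℕ) (S : ℕ) :
    decode (v :: vs) (2 * S + 1) = insert v (decode vs S) := by
  have h1 : (2 * S + 1) % 2 = 1 := by omega
  have h2 : (2 * S + 1) / 2 = S := by omega
  simp [decode, h1, h2]

theorem sum_decode {vs : List ℕ} (hvs : vs.Nodup) (f : Finset ℕ → ℕ) :
    ∑ S ∈ Finset.range (2 ^ vs.length), f (decode vs S) = ∑ s ∈ vs.toFinset.powerset, f s := by
  induction vs generalizing f with
  | nil => simp [decode]
  | cons v vs ih =>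
    rw [List.nodup_cons] at hvs
    rw [List.length_cons, pow_succ', sum_range_two_mul, Finset.sum_add_distrib, List.toFinset_cons,
      Finset.sum_powerset_insert (by simpa using hvs.1)]
    simp only [decode_cons_two_mul, decode_cons_two_mul_add_one]
    rw [ih hvs.2, ih hvs.2 fun s => f (insert v s)]

/-- The total weight of the elements of `A`, where `ps` lists elements with their weights. -/
def setWeight (ps : List (ℕ × ℕ)) (A : Finset ℕ) : ℕ :=
  (ps.map fun p => if p.1 ∈ A then p.2 else 0).sum

theorem setWeight_congr {ps : List (ℕ × ℕ)} {A B : Finset ℕ}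
    (h : ∀ v ∈ ps.map Prod.fst, (v ∈ A ↔ v ∈ B)) : setWeight ps A = setWeight ps B := by
  unfold setWeight
  congr 1
  refine List.map_congr_left fun p hp => ?_
  simp only [h p.1 (List.mem_map_of_mem hp)]

theorem weight_eq_setWeight {ps : List (ℕ × ℕ)} (hps : (ps.map Prod.fst).Nodup) (S : ℕ) :
    weight (ps.map Prod.snd) S = setWeight ps (decode (ps.map Prod.fst) S) := by
  induction ps generalizing S with
  | nil => rfl
  | cons p ps ih =>
    rw [List.map_cons, List.nodup_cons] at hps
    have hp : p.1 ∉ decode (ps.map Prod.fst) (S / 2) := fun h =>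
      hps.1 (List.mem_toFinset.1 (decode_subset _ _ h))
    simp only [List.map_cons, weight, cond_eq_ite, Nat.beq_eq, decode]
    rcases Nat.mod_two_eq_zero_or_one S with h | h
    · rw [if_pos h, if_neg (by omega), ih hps.2]
      simp [setWeight, hp]
    · rw [if_neg (by omega), if_pos h, ih hps.2]
      rw [setWeight_congr (B := insert p.1 (decode (ps.map Prod.fst) (S / 2)))]
      · simp [setWeight]
      · intro v hv
        have : v ≠ p.1 := fun h => hps.1 (h ▸ hv)
        simp [this]

end Decode

section Averaging

variable {F : Finset (Finset ℕ)}

theorem sum_eq_sum_fibres (F : Finset (Finset ℕ)) (V : Finset ℕ) (f : Finset ℕ → ℕ) :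
    ∑ A ∈ F, f A = ∑ Y ∈ F.image (· \ V), ∑ s ∈ V.powerset, if Y ∪ s ∈ F then f (Y ∪ s) else 0 := by
  rw [← Finset.sum_fiberwise_of_maps_to fun A hA => Finset.mem_image_of_mem (· \ V) hA]
  refine Finset.sum_congr rfl fun Y hY => ?_
  obtain ⟨B, -, rfl⟩ := Finset.mem_image.1 hY
  rw [← Finset.sum_filter]
  refine Finset.sum_bij' (fun A _ => A ∩ V) (fun s _ => B \ V ∪ s) ?_ ?_ ?_ ?_ ?_
  · intro A hA
    simp only [Finset.mem_filter] at hA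
    simp only [Finset.mem_filter, Finset.mem_powerset, ← hA.2, Finset.sdiff_union_inter]
    exact ⟨Finset.inter_subset_right, hA.1⟩
  · intro s hs
    simp only [Finset.mem_filter, Finset.mem_powerset] at hs
    simp only [Finset.mem_filter, hs.2, true_and]
    grind
  · intro A hA
    simp only [Finset.mem_filter] at hA
    simp only [← hA.2, Finset.sdiff_union_inter]
  · intro s hs
    simp only [Finset.mem_filter, Finset.mem_powerset] at hs
    grind
  · intro A hA
    simp only [Finset.mem_filter] at hA
    simp only [← hA.2, Finset.sdiff_union_inter]

theorem sum_setWeight (F : Finset (Finset ℕ)) (ps : List (ℕ × ℕ)) :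
    ∑ A ∈ F, setWeight ps A = (ps.map fun p => p.2 * (memFam F p.1).card).sum := by
  induction ps with
  | nil => simp [setWeight]
  | cons p ps ih =>
    simp only [setWeight, List.map_cons, List.sum_cons, Finset.sum_add_distrib] at ih ⊢
    rw [ih, ← Finset.sum_filter, Finset.sum_const, memFam, smul_eq_mul, mul_comm]

theorem card_mul_le_sum_setWeight (hF : UC F) {W : ℕ} {ps : List (ℕ × ℕ)}
    (hps : (ps.map Prod.fst).Nodup) {T : List ℕ}
    (hT : ∀ t ∈ T, decode (ps.map Prod.fst) t ∈ F) {c : Cert}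
    (hc : c.verify W (ps.map Prod.snd) T = true) :
    F.card * W ≤ 2 * ∑ A ∈ F, setWeight ps A := by
  set V := (ps.map Prod.fst).toFinset with hV
  rw [Finset.mul_sum, ← Finset.sum_const_nat (f := fun _ => W) fun _ _ => rfl,
    sum_eq_sum_fibres F V, sum_eq_sum_fibres F V]
  refine Finset.sum_le_sum fun Y hY => ?_
  obtain ⟨B, -, rfl⟩ := Finset.mem_image.1 hY
  rw [← sum_decode hps, ← sum_decode hps]
  have h := c.verify_sound (P := fun S => B \ V ∪ decode (ps.map Prod.fst) S ∈ F)
    (fun S S' hS hS' => by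
      rw [decode_lor, Finset.union_union_distrib_left]
      exact hF _ hS _ hS')
    (fun t ht S hS => by
      rw [decode_lor, ← Finset.union_assoc]
      exact hF _ hS _ (hT t ht)) hc
  simp only [List.length_map] at h ⊢
  have key : ∀ S, setWeight ps (B \ V ∪ decode (ps.map Prod.fst) S) =
      weight (ps.map Prod.snd) S := fun S => by
    rw [weight_eq_setWeight hps]
    refine setWeight_congr fun v hv => ?_
    simp [hV, -List.mem_map, hv]
  simp only [key]
  set x : ℕ → ℕ := fun S => if B \ V ∪ decode (ps.map Prod.fst) S ∈ F then 1 else 0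
  calc _ = ∑ S ∈ Finset.range (2 ^ ps.length), W * x S :=
        Finset.sum_congr rfl fun S _ => by simp [x]
    _ ≤ ∑ S ∈ Finset.range (2 ^ ps.length), 2 * weight (ps.map Prod.snd) S * x S := by
      have hsplit : ∀ S, W * x S + (2 * weight (ps.map Prod.snd) S - W) * x S =
          2 * weight (ps.map Prod.snd) S * x S + (W - 2 * weight (ps.map Prod.snd) S) * x S := by
        intro S
        rw [← add_mul, ← add_mul]
        congr 1
        omega
      have := Finset.sum_congr (rfl : Finset.range (2 ^ ps.length) = _) fun S _ => hsplit S
      rw [Finset.sum_add_distrib, Finset.sum_add_distrib] at this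
      simp only [x] at this h ⊢
      omega
    _ = _ := Finset.sum_congr rfl fun S _ => by simp [x]

/-- The conclusion of Frankl's conjecture for the family `F`. -/
def HasAbundantElement (F : Finset (Finset ℕ)) : Prop :=
  ∃ i ∈ famU F, 2 * (memFam F i).card ≥ F.card

/-- A union-closed family has an abundant element if it contains the sets encoded by the masks `T`
and `T` admits a certificate. -/
theorem hasAbundantElement_of_verify (hF : UC F) {ps : List (ℕ × ℕ)} (hps : (ps.map Prod.fst).Nodup)
    (hpos : 0 < (ps.map Prod.snd).sum) {T : List ℕ} (hne : F.Nonempty)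
    (hT : ∀ t ∈ T, decode (ps.map Prod.fst) t ∈ F) {c : Cert}
    (hc : c.verify (ps.map Prod.snd).sum (ps.map Prod.snd) T = true) :
    HasAbundantElement F := by
  have h := card_mul_le_sum_setWeight hF hps hT hc
  rw [sum_setWeight] at h
  obtain ⟨p, -, hp⟩ : ∃ p ∈ ps, F.card ≤ 2 * (memFam F p.1).card := by
    by_contra! hlt
    have key : 2 * (ps.map fun p => p.2 * (memFam F p.1).card).sum + (ps.map Prod.snd).sum ≤
        F.card * (ps.map Prod.snd).sum := by
      clear h hpos hps hT hc
      induction ps with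
      | nil => simp
      | cons p ps ih =>
        have h1 := ih fun q hq => hlt q (List.mem_cons_of_mem _ hq)
        have h2 := Nat.mul_le_mul_left p.2 (hlt p List.mem_cons_self)
        simp only [List.map_cons, List.sum_cons]
        rw [Nat.succ_eq_add_one] at h2
        linarith
    omega
  refine ⟨p.1, ?_, hp⟩
  have : 0 < (memFam F p.1).card := by
    have := hne.card_pos
    omega
  obtain ⟨A, hA⟩ := Finset.card_pos.1 this
  rw [memFam, Finset.mem_filter] at hA
  exact Finset.mem_sup.2 ⟨A, hA⟩

end Averaging

/-- Certificate for the masks `[7, 11, 13]` with weights `[3, 2, 2, 2]`. -/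
def triangleCert : Cert :=
  .branch 2 (.branch 4 (.branch 1 .leaf .leaf) (.branch 0 .leaf .leaf)) (.branch 4 .leaf
  .leaf)

/-- Certificate for the masks `[13, 14, 28]` with weights `[2, 2, 3, 3, 2]`. -/
def starCert : Cert :=
  .branch 1 (.branch 18 (.branch 0 .leaf .leaf) (.branch 2 (.branch 4 .leaf .leaf) (.branch 0
  (.branch 3 (.branch 4 .leaf .leaf) .leaf) .leaf))) (.branch 2 (.branch 6 (.branch 16 .leaf
  .leaf) .leaf) (.branch 16 .leaf .leaf))

/-- Certificate for the masks `[11, 25, 21]` with weights `[4, 2, 2, 3, 3]`. -/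
def pathCert : Cert :=
  .branch 1 (.branch 10 (.branch 4 .leaf .leaf) (.branch 2 .leaf .leaf)) (.branch 8 (.branch
  16 .leaf .leaf) (.branch 16 .leaf .leaf))

/-- Certificate for the masks `[7, 14, 52]` with weights `[5, 8, 10, 5, 5, 5]`. -/
def cherryEdgeCert : Cert :=
  .branch 4 (.branch 1 (.branch 49 (.branch 3 (.branch 48 .leaf .leaf) (.branch 51 .leaf
  (.branch 16 (.branch 32 .leaf .leaf) (.branch 32 .leaf .leaf)))) (.branch 3 .leaf .leaf))
  (.branch 8 (.branch 48 .leaf .leaf) (.branch 3 .leaf .leaf))) (.branch 9 (.branch 11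
  (.branch 48 (.branch 13 (.branch 2 .leaf .leaf) .leaf) (.branch 16 .leaf (.branch 0 .leaf
  .leaf))) (.branch 16 .leaf (.branch 0 .leaf .leaf))) (.branch 1 (.branch 3 .leaf (.branch 5
  .leaf .leaf)) (.branch 17 (.branch 2 .leaf .leaf) (.branch 33 (.branch 2 .leaf .leaf)
  (.branch 3 .leaf .leaf)))))

/-- Certificate for the masks `[38, 13, 84]` with weights `[1, 1, 2, 1, 1, 1, 1]`. -/
def matchingCert : Cert :=
  .branch 4 (.branch 9 (.branch 34 .leaf (.branch 43 .leaf .leaf)) (.branch 34 (.branch 43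
  .leaf .leaf) (.branch 80 .leaf (.branch 25 .leaf (.branch 1 .leaf .leaf))))) (.branch 17
  (.branch 10 (.branch 51 (.branch 5 (.branch 24 .leaf .leaf) (.branch 48 .leaf .leaf)) .leaf)
  (.branch 51 (.branch 59 (.branch 2 (.branch 3 (.branch 11 (.branch 72 .leaf .leaf) .leaf)
  .leaf) (.branch 9 (.branch 34 (.branch 48 .leaf .leaf) .leaf) (.branch 1 .leaf .leaf)))
  (.branch 15 .leaf .leaf)) (.branch 2 (.branch 1 .leaf .leaf) (.branch 20 .leaf .leaf))))
  (.branch 65 (.branch 10 (.branch 42 (.branch 3 .leaf .leaf) .leaf) (.branch 8 (.branch 99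
  (.branch 88 (.branch 5 .leaf .leaf) .leaf) .leaf) (.branch 99 (.branch 107 (.branch 0
  (.branch 1 (.branch 80 .leaf .leaf) .leaf) .leaf) .leaf) .leaf))) (.branch 9 (.branch 34
  (.branch 36 (.branch 1 .leaf .leaf) (.branch 68 .leaf .leaf)) (.branch 1 .leaf (.branch 40
  (.branch 18 .leaf .leaf) (.branch 6 .leaf .leaf)))) (.branch 34 (.branch 43 (.branch 80
  .leaf .leaf) (.branch 40 .leaf .leaf)) (.branch 80 (.branch 89 (.branch 6 .leaf .leaf)
  .leaf) (.branch 1 .leaf (.branch 10 .leaf (.branch 2 .leaf .leaf))))))))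


theorem triangleCert_verify : triangleCert.verify 9 [3, 2, 2, 2] [7, 11, 13] = true := by
  decide +kernel

theorem starCert_verify : starCert.verify 12 [2, 2, 3, 3, 2] [13, 14, 28] = true := by
  decide +kernel

theorem pathCert_verify : pathCert.verify 14 [4, 2, 2, 3, 3] [11, 25, 21] = true := by
  decide +kernel

theorem cherryEdgeCert_verify :
    cherryEdgeCert.verify 38 [5, 8, 10, 5, 5, 5] [7, 14, 52] = true := by
  decide +kernel

theorem matchingCert_verify : matchingCert.verify 8 [1, 1, 2, 1, 1, 1, 1] [38, 13, 84] = true := by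
  decide +kernel

section Configurations

variable {F : Finset (Finset ℕ)} {x y a b c d e f : ℕ}

theorem hasAbundantElement_of_triangle (hF : UC F) (hnd : [x, a, b, c].Nodup)
    (h1 : {x, a, b} ∈ F) (h2 : {x, a, c} ∈ F) (h3 : {x, b, c} ∈ F) :
    HasAbundantElement F := by
  refine hasAbundantElement_of_verify hF (ps := [(x, 3), (a, 2), (b, 2), (c, 2)])
    hnd (by simp) ⟨_, h1⟩ (T := [7, 11, 13]) ?_ triangleCert_verify
  simp only [List.forall_mem_cons, List.map_cons, List.map_nil]
  refine ⟨?_, ?_, ?_, by simp⟩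
  · convert h1 using 1
    grind [decode]
  · convert h2 using 1
    grind [decode]
  · convert h3 using 1
    grind [decode]

theorem hasAbundantElement_of_star (hF : UC F) (hnd : [a, b, x, y, c].Nodup)
    (h1 : {x, y, a} ∈ F) (h2 : {x, y, b} ∈ F) (h3 : {x, y, c} ∈ F) :
    HasAbundantElement F := by
  refine hasAbundantElement_of_verify hF (ps := [(a, 2), (b, 2), (x, 3), (y, 3), (c, 2)])
    hnd (by simp) ⟨_, h1⟩ (T := [13, 14, 28]) ?_ starCert_verify
  simp only [List.forall_mem_cons, List.map_cons, List.map_nil]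
  refine ⟨?_, ?_, ?_, by simp⟩
  · convert h1 using 1
    grind [decode]
  · convert h2 using 1
    grind [decode]
  · convert h3 using 1
    grind [decode]

theorem hasAbundantElement_of_path (hF : UC F) (hnd : [x, a, d, b, c].Nodup)
    (h1 : {x, a, b} ∈ F) (h2 : {x, b, c} ∈ F) (h3 : {x, c, d} ∈ F) :
    HasAbundantElement F := by
  refine hasAbundantElement_of_verify hF (ps := [(x, 4), (a, 2), (d, 2), (b, 3), (c, 3)])
    hnd (by simp) ⟨_, h1⟩ (T := [11, 25, 21]) ?_ pathCert_verify
  simp only [List.forall_mem_cons, List.map_cons, List.map_nil]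
  refine ⟨?_, ?_, ?_, by simp⟩
  · convert h1 using 1
    grind [decode]
  · convert h2 using 1
    grind [decode]
  · convert h3 using 1
    grind [decode]

theorem hasAbundantElement_of_cherryEdge (hF : UC F) (hnd : [a, b, x, c, d, e].Nodup)
    (h1 : {x, a, b} ∈ F) (h2 : {x, b, c} ∈ F) (h3 : {x, d, e} ∈ F) :
    HasAbundantElement F := by
  refine hasAbundantElement_of_verify hF (ps := [(a, 5), (b, 8), (x, 10), (c, 5), (d, 5), (e, 5)])
    hnd (by simp) ⟨_, h1⟩ (T := [7, 14, 52]) ?_ cherryEdgeCert_verify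
  simp only [List.forall_mem_cons, List.map_cons, List.map_nil]
  refine ⟨?_, ?_, ?_, by simp⟩
  · convert h1 using 1
    grind [decode]
  · convert h2 using 1
    grind [decode]
  · convert h3 using 1
    grind [decode]

theorem hasAbundantElement_of_matching (hF : UC F) (hnd : [a, b, x, c, d, e, f].Nodup)
    (h1 : {x, a, c} ∈ F) (h2 : {x, b, e} ∈ F) (h3 : {x, d, f} ∈ F) :
    HasAbundantElement F := by
  refine hasAbundantElement_of_verify hF
    (ps := [(a, 1), (b, 1), (x, 2), (c, 1), (d, 1), (e, 1), (f, 1)]) hnd (by simp) ⟨_, h1⟩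
    (T := [38, 13, 84]) ?_ matchingCert_verify
  simp only [List.forall_mem_cons, List.map_cons, List.map_nil]
  refine ⟨?_, ?_, ?_, by simp⟩
  · convert h2 using 1
    simp [decode]
    grind
  · convert h1 using 1
    simp [decode]
    grind
  · convert h3 using 1
    simp [decode]

end Configurations

section Cases

variable {F : Finset (Finset ℕ)} {x a b c d e f : ℕ}

theorem hasAbundantElement_of_cherry (hF : UC F) (hnd : [x, a, b, c].Nodup) (hd : d ≠ x)
    (he : e ≠ x) (hde : d ≠ e) (h1 : {x, a, b} ∈ F) (h2 : {x, b, c} ∈ F) (h3 : {x, d, e} ∈ F)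
    (hab : ({d, e} : Finset ℕ) ≠ {a, b}) (hbc : ({d, e} : Finset ℕ) ≠ {b, c}) :
    HasAbundantElement F := by
  wlog hmem : e ∈ [a, b, c] → d ∈ [a, b, c] generalizing d e
  · refine this he hd hde.symm ?_ (Finset.pair_comm d e ▸ hab) (Finset.pair_comm d e ▸ hbc)
      (by tauto)
    rwa [Finset.pair_comm]
  by_cases hd' : d ∈ [a, b, c]
  · by_cases he' : e ∈ [a, b, c]
    · refine hasAbundantElement_of_triangle hF hnd h1 ?_ h2
      convert h3 using 2
      grind
    · simp only [List.mem_cons, List.not_mem_nil, or_false] at hd'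
      rcases hd' with rfl | rfl | rfl
      · refine hasAbundantElement_of_path hF (x := x) (a := c) (b := b) (c := d) (d := e)
          (by grind) ?_ ?_ h3
        · rwa [Finset.pair_comm]
        · rwa [Finset.pair_comm]
      · refine hasAbundantElement_of_star hF (x := x) (y := d) (a := a) (b := c) (c := e)
          (by grind) ?_ h2 h3
        rwa [Finset.pair_comm]
      · exact hasAbundantElement_of_path hF (x := x) (a := a) (b := b) (c := d) (d := e)
          (by grind) h1 h2 h3
  · exact hasAbundantElement_of_cherryEdge hF (by grind) h1 h2 h3

theorem exists_eq_pair_of_mem {E : Finset ℕ} (hE : E.card = 2) (hb : b ∈ E) :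
    ∃ a, b ≠ a ∧ E = {b, a} := by
  obtain ⟨u, v, huv, rfl⟩ := Finset.card_eq_two.1 hE
  rw [Finset.mem_insert, Finset.mem_singleton] at hb
  rcases hb with rfl | rfl
  · exact ⟨v, huv, rfl⟩
  · exact ⟨u, huv.symm, Finset.pair_comm _ _⟩

theorem hasAbundantElement_of_not_disjoint {E₁ E₂ E₃ : Finset ℕ} (hF : UC F) (c₁ : E₁.card = 2)
    (c₂ : E₂.card = 2) (c₃ : E₃.card = 2) (x₁ : x ∉ E₁) (x₂ : x ∉ E₂) (x₃ : x ∉ E₃)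
    (h₁ : insert x E₁ ∈ F) (h₂ : insert x E₂ ∈ F) (h₃ : insert x E₃ ∈ F) (h₁₂ : E₁ ≠ E₂)
    (h₁₃ : E₁ ≠ E₃) (h₂₃ : E₂ ≠ E₃) (hd : ¬ Disjoint E₁ E₂) : HasAbundantElement F := by
  obtain ⟨b, hb₁, hb₂⟩ := Finset.not_disjoint_iff.1 hd
  obtain ⟨a, ha, rfl⟩ := exists_eq_pair_of_mem c₁ hb₁
  obtain ⟨c, hc, rfl⟩ := exists_eq_pair_of_mem c₂ hb₂
  rw [Finset.pair_comm] at h₁₂ h₁₃ h₁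
  obtain ⟨d, e, hde, rfl⟩ := Finset.card_eq_two.1 c₃
  exact hasAbundantElement_of_cherry hF (by grind) (by grind) (by grind) hde h₁ h₂ h₃ h₁₃.symm
    h₂₃.symm

theorem hasAbundantElement_of_three_pairs {E₁ E₂ E₃ : Finset ℕ} (hF : UC F) (c₁ : E₁.card = 2)
    (c₂ : E₂.card = 2) (c₃ : E₃.card = 2) (x₁ : x ∉ E₁) (x₂ : x ∉ E₂) (x₃ : x ∉ E₃)
    (h₁ : insert x E₁ ∈ F) (h₂ : insert x E₂ ∈ F) (h₃ : insert x E₃ ∈ F) (h₁₂ : E₁ ≠ E₂)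
    (h₁₃ : E₁ ≠ E₃) (h₂₃ : E₂ ≠ E₃) : HasAbundantElement F := by
  by_cases d₁₂ : Disjoint E₁ E₂
  · by_cases d₁₃ : Disjoint E₁ E₃
    · by_cases d₂₃ : Disjoint E₂ E₃
      · obtain ⟨a, c, hac, rfl⟩ := Finset.card_eq_two.1 c₁
        obtain ⟨b, e, hbe, rfl⟩ := Finset.card_eq_two.1 c₂
        obtain ⟨d, f, hdf, rfl⟩ := Finset.card_eq_two.1 c₃
        refine hasAbundantElement_of_matching hF ?_ h₁ h₂ h₃
        simp only [Finset.disjoint_insert_left, Finset.disjoint_singleton_left, Finset.mem_insert,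
          Finset.mem_singleton] at d₁₂ d₁₃ d₂₃ x₁ x₂ x₃
        simp
        grind
      · exact hasAbundantElement_of_not_disjoint hF c₂ c₃ c₁ x₂ x₃ x₁ h₂ h₃ h₁ h₂₃ h₁₂.symm
          h₁₃.symm d₂₃
    · exact hasAbundantElement_of_not_disjoint hF c₁ c₃ c₂ x₁ x₃ x₂ h₁ h₃ h₂ h₁₃ h₁₂ h₂₃.symm d₁₃
  · exact hasAbundantElement_of_not_disjoint hF c₁ c₂ c₃ x₁ x₂ x₃ h₁ h₂ h₃ h₁₂ h₁₃ h₂₃ d₁₂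

theorem exists_two_lt_card_memFam {T : Finset (Finset ℕ)} (h3 : ∀ S ∈ T, S.card = 3)
    (hcard : 2 * (famU T).card < 3 * T.card) : ∃ x, 2 < (memFam T x).card := by
  by_contra! h
  have h1 := Finset.sum_card_inter_le (s := famU T) (B := T) (n := 2) fun x _ => h x
  have h2 : ∑ S ∈ T, (famU T ∩ S).card = 3 * T.card := by
    rw [mul_comm]
    refine Finset.sum_const_nat fun S hS => ?_
    have hSU : S ⊆ famU T := Finset.le_sup (f := id) hS
    rw [Finset.inter_eq_right.2 hSU, h3 S hS]
  omega

end Cases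

end Frankl

/-- Vaughan: a family of at least 2n/3 + 1 distinct 3-sets whose union has
cardinality n ≥ 4 forces Frankl's conjecture. -/
theorem vaughan_two_thirds (T : Finset (Finset ℕ)) (h3 : ∀ S ∈ T, S.card = 3)
    (n : ℕ) (hn : 4 ≤ n) (hU : (famU T).card = n) (hcard : 3 * T.card ≥ 2 * n + 3)
    (F : Finset (Finset ℕ)) (hUC : UC F) (hTF : T ⊆ F) :
    ∃ i ∈ famU F, 2 * (memFam F i).card ≥ F.card := by
  obtain ⟨x, hx⟩ := Frankl.exists_two_lt_card_memFam h3 (by omega)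
  obtain ⟨A, hA, B, hB, C, hC, hAB, hAC, hBC⟩ := Finset.two_lt_card.1 hx
  simp only [memFam, Finset.mem_filter] at hA hB hC
  have hcard_erase : ∀ S ∈ T, x ∈ S → (S.erase x).card = 2 := fun S hS hxS => by
    rw [Finset.card_erase_of_mem hxS, h3 S hS]
  have hinj : ∀ S S' : Finset ℕ, x ∈ S → x ∈ S' → S ≠ S' → S.erase x ≠ S'.erase x :=
    fun S S' hS hS' hne h => hne (by rw [← Finset.insert_erase hS, h, Finset.insert_erase hS'])
  refine Frankl.hasAbundantElement_of_three_pairs hUC (x := x) (hcard_erase A hA.1 hA.2)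
    (hcard_erase B hB.1 hB.2) (hcard_erase C hC.1 hC.2) (Finset.notMem_erase _ _)
    (Finset.notMem_erase _ _) (Finset.notMem_erase _ _) ?_ ?_ ?_ (hinj A B hA.2 hB.2 hAB)
    (hinj A C hA.2 hC.2 hAC) (hinj B C hB.2 hC.2 hBC)
  · rw [Finset.insert_erase hA.2]
    exact hTF hA.1
  · rw [Finset.insert_erase hB.2]
    exact hTF hB.1
  · rw [Finset.insert_erase hC.2]
    exact hTF hC.1
end

section
/- Any union-closed family that contains a family of sets isomorphic to {{1,3,5},{2,3,6},{4,5,6}} (i.e., the image of this family under some injective map of ground elements) satisfies Frankl's conjecture: there exists i ∈ U(𝔉) with 2·|𝔉_i| ≥ |𝔉|. -/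
/-- The image of a family under a relabeling of ground elements. -/
def mapFam (f : ℕ → ℕ) (A : Finset (Finset ℕ)) : Finset (Finset ℕ) :=
  A.image (fun S => S.image f)

/-- Twice the weight of the subset of `{0, …, 5}` coded by the binary digits of `X`, where the
elements `0, 1, 2` have weight `3` and the elements `3, 4, 5` have weight `2`. -/
def codeWeight (X : ℕ) : ℕ :=
  6 * ((X.testBit 0).toNat + (X.testBit 1).toNat + (X.testBit 2).toNat) +
    4 * ((X.testBit 3).toNat + (X.testBit 4).toNat + (X.testBit 5).toNat)

/-- The difference between twice the weight of a coded set and the total weight. -/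
def codeShare (X : ℕ) : ℤ := codeWeight X - 15

/-- The codes of negative share, in an order that keeps the search below short. -/
def negativeCodes : List ℕ :=
  [16, 8, 2, 1, 18, 32, 40, 4, 24, 48, 56, 12, 33, 10, 20, 36, 9, 17, 34, 6, 5, 3, 44, 52, 28, 42,
    25, 50, 49, 41, 26, 0]

/-- The codes of negative share, together with the absolute values of their shares. -/
def negativeTable : List (ℕ × ℕ) := negativeCodes.map fun X => (X, 15 - codeWeight X)

/-- The codes of nonnegative share, together with their shares. -/
def nonnegTable : List (ℕ × ℕ) :=
  ((List.range 64).filter fun X => 15 ≤ codeWeight X).map fun X => (X, codeWeight X - 15)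

/-- The sum of the tabulated values over the binary digits of `M`. The recursor is used directly
because it evaluates faster in the kernel. -/
noncomputable def tally (M : ℕ) (l : List (ℕ × ℕ)) : ℕ :=
  List.rec 0 (fun p _ t => Nat.add (Nat.mul (Nat.mod (Nat.shiftRight M p.1) 2) p.2) t) l

/-- The family of coded sets given by the binary digits of `M` has nonnegative total share. -/
noncomputable def nonnegShare (M : ℕ) : Bool :=
  Nat.ble (tally M negativeTable) (tally M nonnegTable)

/-- For each element `e` of `{0, …, 5}`, the code `2 ^ e` of the singleton `{e}`, together with
the family of all sets avoiding `e`. -/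
def elementTable : List (ℕ × ℕ) :=
  [(1, 6148914691236517205), (2, 3689348814741910323), (4, 1085102592571150095),
    (8, 71777214294589695), (16, 281470681808895), (32, 4294967295)]

/-- The family of all unions of the set coded by `s` with a member of the family `F`. -/
def joinSet (s F : ℕ) : List (ℕ × ℕ) → ℕ
  | [] => F
  | p :: l =>
    cond (Nat.beq (s &&& p.1) 0) (joinSet s F l)
      (((joinSet s F l ||| joinSet s F l >>> p.1) &&& p.2) <<< p.1)

/-- The family of all nonempty unions of the sets coded by `11`, `21` and `38`. -/
def triangleUnions : ℕ := 9259541848389584896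

/-- The family `F` enlarged by the set coded by `s` and by the unions this forces. -/
def addSet (s F : ℕ) : ℕ :=
  1 <<< s ||| F ||| joinSet s (F ||| triangleUnions) elementTable

/-- The family `F` together with all sets in the list `l`. -/
def withSets (F : ℕ) : List ℕ → ℕ
  | [] => F
  | s :: l => 1 <<< s ||| withSets F l

/-- Branch on the membership of the sets in a list, discarding a branch as soon as its share stays
nonnegative even when all undecided sets are added. -/
noncomputable def search : List ℕ → ℕ → Bool
  | [], F => nonnegShare F
  | s :: l, F =>
    cond (F.testBit s) (search l F)
      (nonnegShare (withSets F (s :: l)) || (search l (addSet s F) && search l F))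

theorem search_negativeCodes : search negativeCodes 0 = true := by
  decide +kernel

theorem tally_map (M : ℕ) (w : ℕ → ℕ) (l : List ℕ) :
    tally M (l.map fun X => (X, w X)) = (l.map fun X => if M.testBit X then w X else 0).sum := by
  induction l with
  | nil => rfl
  | cons X l ih =>
    have h : tally M ((X :: l).map fun X => (X, w X)) =
        M >>> X % 2 * w X + tally M (l.map fun X => (X, w X)) := rfl
    rw [h, ih, List.map_cons, List.sum_cons, Nat.testBit_eq_decide_div_mod_eq,
      Nat.shiftRight_eq_div_pow]
    rcases Nat.mod_two_eq_zero_or_one (M / 2 ^ X) with h | h <;> simp [h]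

theorem sum_codeShare_nonneg_of_nonnegShare {M : ℕ} (h : nonnegShare M = true) :
    0 ≤ ∑ X ∈ Finset.range 64, if M.testBit X then codeShare X else 0 := by
  have h' := Nat.le_of_ble_eq_true h
  rw [negativeTable, nonnegTable, tally_map M fun X => 15 - codeWeight X,
    tally_map M fun X => codeWeight X - 15,
    ← List.sum_toFinset _ (by decide +kernel), ← List.sum_toFinset _ (by decide +kernel)] at h'
  have hneg : negativeCodes.toFinset = (Finset.range 64).filter fun X => ¬ 15 ≤ codeWeight X := by
    decide +kernel
  have hpos : ((List.range 64).filter fun X => 15 ≤ codeWeight X).toFinset =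
      (Finset.range 64).filter fun X => 15 ≤ codeWeight X := by
    decide +kernel
  rw [hneg, hpos] at h'
  rw [← Finset.sum_filter_add_sum_filter_not _ fun X => 15 ≤ codeWeight X]
  have h₁ : ∑ X ∈ (Finset.range 64).filter (fun X => 15 ≤ codeWeight X),
      (if M.testBit X then codeShare X else 0) =
      ((∑ X ∈ (Finset.range 64).filter (fun X => 15 ≤ codeWeight X),
        if M.testBit X then codeWeight X - 15 else 0 : ℕ) : ℤ) := by
    rw [Nat.cast_sum]
    refine Finset.sum_congr rfl fun X hX => ?_
    have := (Finset.mem_filter.1 hX).2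
    unfold codeShare
    split_ifs <;> omega
  have h₂ : ∑ X ∈ (Finset.range 64).filter (fun X => ¬ 15 ≤ codeWeight X),
      (if M.testBit X then codeShare X else 0) =
      -((∑ X ∈ (Finset.range 64).filter (fun X => ¬ 15 ≤ codeWeight X),
        if M.testBit X then 15 - codeWeight X else 0 : ℕ) : ℤ) := by
    rw [Nat.cast_sum, ← Finset.sum_neg_distrib]
    refine Finset.sum_congr rfl fun X hX => ?_
    have := (Finset.mem_filter.1 hX).2
    unfold codeShare
    split_ifs <;> omega
  rw [h₁, h₂]
  omega

theorem elementTable_spec : ∀ p ∈ elementTable, p.2 < 2 ^ 64 ∧ ∀ X < 64, p.2.testBit X = true →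
    p.1 + X = X ||| p.1 ∧ (p.1 + X) ||| p.1 = p.1 + X := by
  decide +kernel

/-- The digits of `joinSet s F l` code unions of members of `F` with a fixed part of `s`. -/
theorem exists_of_testBit_joinSet (s F : ℕ) (l : List (ℕ × ℕ)) (hl : ∀ p ∈ l, p ∈ elementTable)
    {Y : ℕ} (hY : (joinSet s F l).testBit Y = true) :
    ∃ X, F.testBit X = true ∧
      Y = X ||| l.foldr (fun p t => cond (Nat.beq (s &&& p.1) 0) t (t ||| p.1)) 0 := by
  induction l generalizing Y with
  | nil => exact ⟨Y, hY, by simp⟩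
  | cons p l ih =>
    specialize @ih fun q hq => hl q (List.mem_cons_of_mem _ hq)
    rw [joinSet] at hY
    rw [List.foldr_cons]
    cases hb : Nat.beq (s &&& p.1) 0 with
    | true =>
      rw [hb] at hY
      exact ih hY
    | false =>
      rw [hb] at hY
      simp only [cond_false, Nat.testBit_shiftLeft, Nat.testBit_and, Nat.testBit_or,
        Nat.testBit_shiftRight, Bool.and_eq_true, decide_eq_true_eq, Bool.or_eq_true] at hY
      obtain ⟨hpY, hF, hp⟩ := hY
      obtain ⟨hlt, hspec⟩ := elementTable_spec p (hl p List.mem_cons_self)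
      have h64 : Y - p.1 < 64 := by
        by_contra! hge
        rw [Nat.testBit_lt_two_pow (hlt.trans_le (Nat.pow_le_pow_right (by norm_num) hge))] at hp
        exact absurd hp (by decide)
      obtain ⟨h₁, h₂⟩ := hspec _ h64 hp
      rw [Nat.add_sub_cancel' hpY] at h₁ h₂ hF
      simp only [cond_false]
      rcases hF with hF | hF
      · obtain ⟨X, hX, hXY⟩ := ih hF
        exact ⟨X, hX, by rw [h₁, hXY, Nat.or_assoc]⟩
      · obtain ⟨X, hX, hXY⟩ := ih hF
        exact ⟨X, hX, by rw [← Nat.or_assoc, ← hXY, h₂]⟩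

theorem foldr_elementTable : ∀ s < 64, elementTable.foldr
    (fun p t => cond (Nat.beq (s &&& p.1) 0) t (t ||| p.1)) 0 = s := by
  decide +kernel

theorem mem_of_testBit_triangleUnions {X : ℕ} (hX : triangleUnions.testBit X = true) :
    X ∈ [11, 21, 38, 11 ||| 21, 11 ||| 38, 21 ||| 38, 11 ||| 21 ||| 38] := by
  have hlt : X < 64 := by
    by_contra! hge
    rw [Nat.testBit_lt_two_pow ((by decide : triangleUnions < 2 ^ 64).trans_le
      (Nat.pow_le_pow_right (by norm_num) hge))] at hX
    exact absurd hX (by decide)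
  have key : ∀ X < 64, triangleUnions.testBit X = true →
      X ∈ [11, 21, 38, 11 ||| 21, 11 ||| 38, 21 ||| 38, 11 ||| 21 ||| 38] := by
    decide +kernel
  exact key X hlt hX

/-- Closure of a family of coded sets under unions of its members with each other and with the
three sets coded by `11`, `21` and `38`. -/
structure IsTriangleClosed (g : ℕ → Prop) : Prop where
  union : ∀ X Y, g X → g Y → g (X ||| Y)
  union_triangle : ∀ X, g X → ∀ t ∈ [11, 21, 38], g (X ||| t)

theorem IsTriangleClosed.of_testBit_addSet {g : ℕ → Prop} (hg : IsTriangleClosed g) {s F : ℕ}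
    (hs : s < 64) (hgs : g s) (hF : ∀ X, F.testBit X = true → g X) {Y : ℕ}
    (hY : (addSet s F).testBit Y = true) : g Y := by
  rw [addSet, Nat.testBit_or, Nat.testBit_or, Bool.or_eq_true, Bool.or_eq_true,
    Nat.one_shiftLeft, Nat.testBit_two_pow, decide_eq_true_eq] at hY
  rcases hY with (rfl | hY) | hY
  · exact hgs
  · exact hF Y hY
  obtain ⟨X, hX, rfl⟩ := exists_of_testBit_joinSet _ _ _ (fun _ => id) hY
  rw [foldr_elementTable s hs]
  rw [Nat.testBit_or, Bool.or_eq_true] at hX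
  rcases hX with hX | hX
  · exact hg.union _ _ (hF X hX) hgs
  rw [Nat.or_comm]
  have h₁ := fun X hX => hg.union_triangle X hX 11 (by simp)
  have h₂ := fun X hX => hg.union_triangle X hX 21 (by simp)
  have h₃ := fun X hX => hg.union_triangle X hX 38 (by simp)
  have := mem_of_testBit_triangleUnions hX
  simp only [List.mem_cons, List.not_mem_nil, or_false] at this
  rcases this with rfl | rfl | rfl | rfl | rfl | rfl | rfl
  · exact h₁ _ hgs
  · exact h₂ _ hgs
  · exact h₃ _ hgs
  · rw [← Nat.or_assoc]
    exact h₂ _ (h₁ _ hgs)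
  · rw [← Nat.or_assoc]
    exact h₃ _ (h₁ _ hgs)
  · rw [← Nat.or_assoc]
    exact h₃ _ (h₂ _ hgs)
  · rw [← Nat.or_assoc, ← Nat.or_assoc]
    exact h₃ _ (h₂ _ (h₁ _ hgs))

theorem testBit_withSets (F : ℕ) (l : List ℕ) (X : ℕ) :
    (withSets F l).testBit X = true ↔ F.testBit X = true ∨ X ∈ l := by
  induction l with
  | nil => simp [withSets]
  | cons s l ih =>
    rw [withSets, Nat.testBit_or, Bool.or_eq_true, ih, Nat.one_shiftLeft, Nat.testBit_two_pow,
      List.mem_cons, decide_eq_true_eq]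
    tauto

theorem sum_codeShare_nonneg_of_withSets {g : ℕ → Prop} [DecidablePred g] {F : ℕ} {l : List ℕ}
    (hF : ∀ X, F.testBit X = true → g X) (hl : ∀ s ∈ l, codeShare s < 0)
    (hneg : ∀ X < 64, g X → codeShare X < 0 → F.testBit X = true ∨ X ∈ l)
    (h : nonnegShare (withSets F l) = true) :
    0 ≤ ∑ X ∈ Finset.range 64, if g X then codeShare X else 0 := by
  refine (sum_codeShare_nonneg_of_nonnegShare h).trans (Finset.sum_le_sum fun X hX => ?_)
  simp only [testBit_withSets]
  rcases lt_or_ge (codeShare X) 0 with hX' | hX'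
  · by_cases hgX : g X
    · rw [if_pos hgX, if_pos (hneg X (Finset.mem_range.1 hX) hgX hX')]
    · rw [if_neg hgX]
      split_ifs <;> omega
  · by_cases hgX : g X
    · rw [if_pos hgX]
      split_ifs <;> omega
    · rw [if_neg hgX, if_neg]
      rintro (hXF | hXl)
      · exact hgX (hF X hXF)
      · exact absurd (hl X hXl) (not_lt.2 hX')

theorem IsTriangleClosed.sum_nonneg_of_search {g : ℕ → Prop} [DecidablePred g]
    (hg : IsTriangleClosed g) (l : List ℕ) (F : ℕ) (hF : ∀ X, F.testBit X = true → g X)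
    (hl : ∀ s ∈ l, s < 64 ∧ codeShare s < 0)
    (hneg : ∀ X < 64, g X → codeShare X < 0 → F.testBit X = true ∨ X ∈ l)
    (h : search l F = true) :
    0 ≤ ∑ X ∈ Finset.range 64, if g X then codeShare X else 0 := by
  induction l generalizing F with
  | nil => exact sum_codeShare_nonneg_of_withSets hF (fun s hs => (hl s hs).2) hneg h
  | cons s l ih =>
    rw [search] at h
    have hl' : ∀ t ∈ l, t < 64 ∧ codeShare t < 0 := fun t ht => hl t (List.mem_cons_of_mem _ ht)
    cases hs : F.testBit s with
    | true =>
      rw [hs] at h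
      refine ih F hF hl' (fun X hX hgX hX' => ?_) h
      rcases hneg X hX hgX hX' with hXF | hXl
      · exact Or.inl hXF
      · rcases List.mem_cons.1 hXl with rfl | hXl
        · exact Or.inl hs
        · exact Or.inr hXl
    | false =>
      rw [hs, cond_false, Bool.or_eq_true, Bool.and_eq_true] at h
      rcases h with h | ⟨hin, hout⟩
      · exact sum_codeShare_nonneg_of_withSets hF (fun s hs => (hl s hs).2) hneg h
      by_cases hgs : g s
      · refine ih _ (fun X => hg.of_testBit_addSet (hl s List.mem_cons_self).1 hgs hF) hl'
          (fun X hX hgX hX' => ?_) hin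
        rw [addSet, Nat.testBit_or, Nat.testBit_or, Nat.one_shiftLeft, Nat.testBit_two_pow]
        rcases hneg X hX hgX hX' with hXF | hXl
        · simp [hXF]
        · rcases List.mem_cons.1 hXl with rfl | hXl
          · simp
          · exact Or.inr hXl
      · refine ih F hF hl' (fun X hX hgX hX' => ?_) hout
        rcases hneg X hX hgX hX' with hXF | hXl
        · exact Or.inl hXF
        · rcases List.mem_cons.1 hXl with rfl | hXl
          · exact absurd hgX hgs
          · exact Or.inr hXl

theorem IsTriangleClosed.sum_codeShare_nonneg {g : ℕ → Prop} [DecidablePred g]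
    (hg : IsTriangleClosed g) :
    0 ≤ ∑ X ∈ Finset.range 64, if g X then codeShare X else 0 := by
  have key : ∀ X < 64, codeShare X < 0 → X ∈ negativeCodes := by
    decide +kernel
  refine hg.sum_nonneg_of_search negativeCodes 0 (by simp) (by decide +kernel)
    (fun X hX _ hX' => Or.inr (key X hX hX')) search_negativeCodes

/-- The set obtained from `K` by adding the elements `p e` for which `X` has the digit `e < 6`. -/
def decodeSet (p : ℕ → ℕ) (K : Finset ℕ) (X : ℕ) : Finset ℕ :=
  K ∪ ((Finset.range 6).filter fun e => X.testBit e = true).image p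

theorem mem_decodeSet {p : ℕ → ℕ} {K : Finset ℕ} {X a : ℕ} :
    a ∈ decodeSet p K X ↔ a ∈ K ∨ ∃ e < 6, X.testBit e = true ∧ p e = a := by
  simp [decodeSet, and_assoc]

theorem decodeSet_or (p : ℕ → ℕ) (K : Finset ℕ) (X Y : ℕ) :
    decodeSet p K (X ||| Y) = decodeSet p K X ∪ decodeSet p K Y := by
  ext a
  simp only [Finset.mem_union, mem_decodeSet, Nat.testBit_or, Bool.or_eq_true, or_and_right,
    and_or_left, exists_or]
  exact or_or_distrib_left

theorem decodeSet_eq_union (p : ℕ → ℕ) (K : Finset ℕ) (X : ℕ) :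
    decodeSet p K X = K ∪ decodeSet p ∅ X := by
  simp [decodeSet]

theorem isTriangleClosed_decodeSet {F : Finset (Finset ℕ)} (hUC : UC F) {p : ℕ → ℕ}
    (hp : ∀ t ∈ [11, 21, 38], decodeSet p ∅ t ∈ F) (K : Finset ℕ) :
    IsTriangleClosed fun X => decodeSet p K X ∈ F where
  union X Y hX hY := by
    rw [decodeSet_or]
    exact hUC _ hX _ hY
  union_triangle X hX t ht := by
    have : decodeSet p K (X ||| t) = decodeSet p K X ∪ decodeSet p ∅ t := by
      rw [decodeSet_or, decodeSet_eq_union p K X, decodeSet_eq_union p K t]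
      ext a
      simp only [Finset.mem_union]
      tauto
    rw [this]
    exact hUC _ hX _ (hp t ht)

/-- The share of a set `A` with respect to the weighted elements `p 0, …, p 5`. -/
def setShare (p : ℕ → ℕ) (A : Finset ℕ) : ℤ :=
  6 * ((if p 0 ∈ A then 1 else 0) + (if p 1 ∈ A then 1 else 0) + (if p 2 ∈ A then 1 else 0)) +
    4 * ((if p 3 ∈ A then 1 else 0) + (if p 4 ∈ A then 1 else 0) + (if p 5 ∈ A then 1 else 0)) - 15

section Decode

variable {p : ℕ → ℕ} {K : Finset ℕ}

theorem apply_mem_decodeSet_iff (hp : Set.InjOn p (Set.Iio 6)) (hK : ∀ e < 6, p e ∉ K) {X e : ℕ}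
    (he : e < 6) : p e ∈ decodeSet p K X ↔ X.testBit e = true := by
  rw [mem_decodeSet]
  refine ⟨?_, fun h => Or.inr ⟨e, he, h, rfl⟩⟩
  rintro (h | ⟨e', he', h, heq⟩)
  · exact absurd h (hK e he)
  · rwa [← hp he' he heq]

theorem setShare_decodeSet (hp : Set.InjOn p (Set.Iio 6)) (hK : ∀ e < 6, p e ∉ K) (X : ℕ) :
    setShare p (decodeSet p K X) = codeShare X := by
  have h := fun e he => apply_mem_decodeSet_iff hp hK (X := X) (e := e) he
  simp only [setShare, codeShare, codeWeight, Bool.toNat, h 0 (by norm_num), h 1 (by norm_num),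
    h 2 (by norm_num), h 3 (by norm_num), h 4 (by norm_num), h 5 (by norm_num), Bool.cond_eq_ite]
  push_cast
  rfl

theorem decodeSet_injOn (hp : Set.InjOn p (Set.Iio 6)) (hK : ∀ e < 6, p e ∉ K) :
    Set.InjOn (decodeSet p K) (Set.Iio 64) := by
  intro X hX Y hY h
  refine Nat.eq_of_testBit_eq fun e => ?_
  rcases lt_or_ge e 6 with he | he
  · rw [Bool.eq_iff_iff, ← apply_mem_decodeSet_iff hp hK he, h, apply_mem_decodeSet_iff hp hK he]
  · have hpow : 2 ^ 6 ≤ 2 ^ e := Nat.pow_le_pow_right (by norm_num) he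
    rw [Nat.testBit_lt_two_pow (lt_of_lt_of_le hX hpow),
      Nat.testBit_lt_two_pow (lt_of_lt_of_le hY hpow)]

theorem decodeSet_sdiff (hK : ∀ e < 6, p e ∉ K) (X : ℕ) :
    decodeSet p K X \ (Finset.range 6).image p = K := by
  ext a
  simp only [Finset.mem_sdiff, mem_decodeSet, Finset.mem_image, Finset.mem_range]
  constructor
  · rintro ⟨h | ⟨e, he, -, rfl⟩, h'⟩
    · exact h
    · exact absurd ⟨e, he, rfl⟩ h'
  · refine fun h => ⟨Or.inl h, ?_⟩
    rintro ⟨e, he, rfl⟩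
    exact hK e he h

theorem exists_decodeSet_eq (A : Finset ℕ) :
    ∃ X < 64, decodeSet p (A \ (Finset.range 6).image p) X = A := by
  refine ⟨Nat.ofBits fun e : Fin 6 => decide (p e ∈ A), Nat.ofBits_lt_two_pow _, ?_⟩
  ext a
  simp only [mem_decodeSet, Finset.mem_sdiff, Finset.mem_image, Finset.mem_range]
  constructor
  · rintro (h | ⟨e, he, h, rfl⟩)
    · exact h.1
    · rwa [Nat.testBit_ofBits_lt _ _ he, decide_eq_true_eq] at h
  · intro ha
    by_cases h : ∃ e < 6, p e = a
    · obtain ⟨e, he, rfl⟩ := h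
      exact Or.inr ⟨e, he, by rwa [Nat.testBit_ofBits_lt _ _ he, decide_eq_true_eq], rfl⟩
    · exact Or.inl ⟨ha, h⟩

end Decode

theorem sum_setShare_nonneg {F : Finset (Finset ℕ)} (hUC : UC F) {p : ℕ → ℕ}
    (hp : Set.InjOn p (Set.Iio 6)) (hT : ∀ t ∈ [11, 21, 38], decodeSet p ∅ t ∈ F) :
    0 ≤ ∑ A ∈ F, setShare p A := by
  rw [← Finset.sum_fiberwise_of_maps_to
    fun A hA => Finset.mem_image_of_mem (fun A => A \ (Finset.range 6).image p) hA]
  refine Finset.sum_nonneg fun K hK => ?_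
  obtain ⟨B, -, rfl⟩ := Finset.mem_image.1 hK
  set K := B \ (Finset.range 6).image p with hKdef
  have hpK : ∀ e < 6, p e ∉ K := fun e he h =>
    (Finset.mem_sdiff.1 h).2 (Finset.mem_image_of_mem p (Finset.mem_range.2 he))
  refine (isTriangleClosed_decodeSet hUC hT K).sum_codeShare_nonneg.trans_eq ?_
  rw [← Finset.sum_filter]
  refine Finset.sum_bij (fun X _ => decodeSet p K X) ?_ ?_ ?_ ?_
  · intro X hX
    exact Finset.mem_filter.2 ⟨(Finset.mem_filter.1 hX).2, decodeSet_sdiff hpK X⟩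
  · intro X hX Y hY h
    exact decodeSet_injOn hp hpK (Finset.mem_range.1 (Finset.mem_filter.1 hX).1)
      (Finset.mem_range.1 (Finset.mem_filter.1 hY).1) h
  · intro A hA
    obtain ⟨hAF, hAK⟩ := Finset.mem_filter.1 hA
    obtain ⟨X, hX, hXA⟩ := exists_decodeSet_eq (p := p) A
    rw [hAK] at hXA
    refine ⟨X, Finset.mem_filter.2 ⟨Finset.mem_range.2 hX, ?_⟩, hXA⟩
    rwa [hXA]
  · intro X _
    exact (setShare_decodeSet hp hpK X).symm

theorem sum_setShare_eq (F : Finset (Finset ℕ)) (p : ℕ → ℕ) :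
    ∑ A ∈ F, setShare p A =
      6 * ((memFam F (p 0)).card + (memFam F (p 1)).card + (memFam F (p 2)).card) +
        4 * ((memFam F (p 3)).card + (memFam F (p 4)).card + (memFam F (p 5)).card) -
        15 * F.card := by
  simp only [setShare, memFam, Finset.card_filter, Finset.sum_sub_distrib, Finset.sum_add_distrib,
    ← Finset.mul_sum, Finset.sum_const, nsmul_eq_mul]
  push_cast
  ring

theorem frankl_of_contains_iso_135_236_456 (F : Finset (Finset ℕ)) (hUC : UC F)
    (f : ℕ → ℕ) (hf : Function.Injective f)
    (hcont : mapFam f ({{1,3,5},{2,3,6},{4,5,6}} : Finset (Finset ℕ)) ⊆ F) :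
    ∃ i ∈ famU F, 2 * (memFam F i).card ≥ F.card := by
  have h₁ : {f 1, f 3, f 5} ∈ F := hcont (by simp [mapFam])
  have h₂ : {f 2, f 3, f 6} ∈ F := hcont (by simp [mapFam])
  have h₃ : {f 4, f 5, f 6} ∈ F := hcont (by simp [mapFam])
  let q : ℕ → ℕ := fun e => [3, 5, 6, 1, 2, 4].getD e 0
  have hq : Set.InjOn q (Set.Iio 6) := by
    have : ∀ a < 6, ∀ b < 6, q a = q b → a = b := by decide
    exact fun a ha b hb => this a ha b hb
  have hT : ∀ t ∈ [11, 21, 38], decodeSet (f ∘ q) ∅ t ∈ F := by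
    have hdec : ∀ t, decodeSet (f ∘ q) ∅ t =
        (((Finset.range 6).filter fun e => t.testBit e = true).image q).image f := fun t => by
      rw [decodeSet, Finset.empty_union, Finset.image_image]
    have h11 : ((Finset.range 6).filter fun e => (11).testBit e = true).image q = {1, 3, 5} := by
      decide
    have h21 : ((Finset.range 6).filter fun e => (21).testBit e = true).image q = {2, 3, 6} := by
      decide
    have h38 : ((Finset.range 6).filter fun e => (38).testBit e = true).image q = {4, 5, 6} := by
      decide
    intro t ht
    simp only [List.mem_cons, List.not_mem_nil, or_false] at ht
    rw [hdec]
    rcases ht with rfl | rfl | rfl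
    · simpa [h11] using h₁
    · simpa [h21] using h₂
    · simpa [h38] using h₃
  have hsum := sum_setShare_nonneg hUC (hf.comp_injOn hq) hT
  rw [sum_setShare_eq] at hsum
  change (0 : ℤ) ≤ 6 * ((memFam F (f 3)).card + (memFam F (f 5)).card + (memFam F (f 6)).card) +
    4 * ((memFam F (f 1)).card + (memFam F (f 2)).card + (memFam F (f 4)).card) -
    15 * F.card at hsum
  have hmem : ∀ A ∈ F, ∀ i ∈ A, i ∈ famU F := fun A hA i hi =>
    Finset.mem_sup.2 ⟨A, hA, hi⟩
  by_contra! hlt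
  have := hlt _ (hmem _ h₁ (f 1) (by simp))
  have := hlt _ (hmem _ h₁ (f 3) (by simp))
  have := hlt _ (hmem _ h₁ (f 5) (by simp))
  have := hlt _ (hmem _ h₂ (f 2) (by simp))
  have := hlt _ (hmem _ h₂ (f 6) (by simp))
  have := hlt _ (hmem _ h₃ (f 4) (by simp))
  omega
end

section
/- Any union-closed family 𝔉 that contains three distinct 3-sets having a common element satisfies Frankl's conjecture: there exists i ∈ U(𝔉) with 2·|𝔉_i| ≥ |𝔉|. -/
/-! ### Integer tables indexed by bitmasks -/

/-- A vector of integers indexed by the `n`-bit masks, as a binary tree that branches on the least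
significant bit first. -/
inductive MaskTable : ℕ → Type
  | leaf (a : ℤ) : MaskTable 0
  | node {n : ℕ} (l r : MaskTable n) : MaskTable (n + 1)

namespace MaskTable

/-- The pairing of a table with a function on masks. -/
def total : {n : ℕ} → MaskTable n → (ℕ → ℤ) → ℤ
  | _, leaf a, h => a * h 0
  | _, node l r, h => l.total (fun m => h (2 * m)) + r.total (fun m => h (2 * m + 1))

/-- The entry at a given mask. -/
def get : {n : ℕ} → MaskTable n → ℕ → ℤ
  | _, leaf a, _ => a
  | _, node l r, m => if m % 2 = 0 then l.get (m / 2) else r.get (m / 2)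

/-- Adds `d` to the entry at a given mask. -/
def add : {n : ℕ} → MaskTable n → ℕ → ℤ → MaskTable n
  | _, leaf a, _, d => leaf (a + d)
  | _, node l r, m, d => if m % 2 = 0 then node (l.add (m / 2) d) r else node l (r.add (m / 2) d)

/-- The sum of the negative parts of the entries. -/
def negSum : {n : ℕ} → MaskTable n → ℤ
  | _, leaf a => min a 0
  | _, node l r => l.negSum + r.negSum

/-- The table whose entry at `m` is `a` plus the sum of the weights selected by `m` minus the sum
of the other weights. -/
def ofWeights : (ws : List ℤ) → ℤ → MaskTable ws.length
  | [], a => leaf a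
  | w :: ws, a => node (ofWeights ws (a - w)) (ofWeights ws (a + w))

theorem total_add {n : ℕ} (t : MaskTable n) (m : ℕ) (hm : m < 2 ^ n) (d : ℤ) (h : ℕ → ℤ) :
    (t.add m d).total h = t.total h + d * h m := by
  induction t generalizing m h with
  | leaf a =>
    obtain rfl : m = 0 := by simpa using hm
    simp only [add, total]
    ring
  | @node k l r ihl ihr =>
    have hlt : m / 2 < 2 ^ k := by rw [pow_succ] at hm; omega
    unfold add
    split_ifs with hpar
    · have hm2 : 2 * (m / 2) = m := by omega
      simp only [total, ihl _ hlt, hm2]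
      ring
    · have hm2 : 2 * (m / 2) + 1 = m := by omega
      simp only [total, ihr _ hlt, hm2]
      ring

theorem negSum_le_total {n : ℕ} (t : MaskTable n) (h : ℕ → ℤ) (h0 : ∀ m, 0 ≤ h m)
    (h1 : ∀ m, h m ≤ 1) : t.negSum ≤ t.total h := by
  induction t generalizing h with
  | leaf a =>
    simp only [negSum, total]
    rcases le_total a 0 with ha | ha
    · rw [min_eq_left ha]
      nlinarith [h1 0]
    · rw [min_eq_right ha]
      exact mul_nonneg ha (h0 0)
  | node l r ihl ihr =>
    exact add_le_add (ihl _ (fun _ => h0 _) (fun _ => h1 _)) (ihr _ (fun _ => h0 _) (fun _ => h1 _))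

/-- Whether `T` is the union of `S` and those members of `gens` that are contained in `T`. -/
def reaches (gens : List ℕ) (S T : ℕ) : Bool :=
  decide (gens.foldl (fun acc g => if g ||| T = T then acc ||| g else acc) S = T)

theorem le_of_reaches {gens : List ℕ} {S T : ℕ} (hr : reaches gens S T = true) {h : ℕ → ℤ}
    (hh : ∀ g ∈ gens, ∀ m, h m ≤ h (m ||| g)) : h S ≤ h T := by
  have key : ∀ m, h m ≤ h (gens.foldl (fun acc g => if g ||| T = T then acc ||| g else acc) m) := by
    clear hr
    induction gens with
    | nil => exact fun m => le_rfl
    | cons g gs ih =>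
      intro m
      have ih' := ih fun g' hg' => hh g' (List.mem_cons_of_mem _ hg')
      rw [List.foldl_cons]
      split_ifs
      · exact (hh g List.mem_cons_self m).trans (ih' _)
      · exact ih' m
  have hT := key S
  rwa [of_decide_eq_true hr] at hT

/-- Cancels a negative entry at `p.1` against a positive entry at `p.2`, as far as possible, when
`p.2` is reachable from `p.1`. -/
def push (gens : List ℕ) {n : ℕ} (t : MaskTable n) (p : ℕ × ℕ) : MaskTable n :=
  let d := min (-t.get p.1) (t.get p.2)
  if p.1 < 2 ^ n ∧ p.2 < 2 ^ n ∧ 0 ≤ d ∧ reaches gens p.1 p.2 = true then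
    (t.add p.1 d).add p.2 (-d)
  else t

theorem total_push_le (gens : List ℕ) {n : ℕ} (t : MaskTable n) (p : ℕ × ℕ) {h : ℕ → ℤ}
    (hh : ∀ g ∈ gens, ∀ m, h m ≤ h (m ||| g)) : (t.push gens p).total h ≤ t.total h := by
  unfold push
  extract_lets d
  split_ifs with hp
  · obtain ⟨hS, hT, hd, hr⟩ := hp
    rw [total_add _ _ hT, total_add _ _ hS]
    nlinarith [le_of_reaches hr hh]
  · exact le_rfl

theorem total_foldl_push_le (gens : List ℕ) {n : ℕ} (ps : List (ℕ × ℕ)) (t : MaskTable n)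
    {h : ℕ → ℤ} (hh : ∀ g ∈ gens, ∀ m, h m ≤ h (m ||| g)) :
    (ps.foldl (push gens) t).total h ≤ t.total h := by
  induction ps generalizing t with
  | nil => exact le_rfl
  | cons p ps ih => exact (ih _).trans (total_push_le gens t p hh)

end MaskTable

/-! ### Certificates -/

/-- A proof tree for the nonnegativity of a weighted count over all union-closed families of masks.
Each node lists cancellations; `split` distinguishes whether a given mask is in the family. -/
inductive MaskCert
  | leaf (pushes : List (ℕ × ℕ))
  | split (pushes : List (ℕ × ℕ)) (s : ℕ) (mem notMem : MaskCert)

namespace MaskCert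

open MaskTable

/-- The validity test for certificates. The masks in `gens` may be united with every member of the
family; the constant `c` records what was subtracted from the entries of masks known to be in the
family. -/
def check {n : ℕ} : MaskCert → List ℕ → MaskTable n → ℤ → Bool
  | leaf ps, gens, t, c => decide (0 ≤ c + (ps.foldl (push gens) t).negSum)
  | split ps s mem notMem, gens, t, c =>
    decide (s < 2 ^ n) &&
      (mem.check (s :: gens) ((ps.foldl (push gens) t).add s (-2000)) (c + 2000) &&
        notMem.check gens ((ps.foldl (push gens) t).add s 2000) c)

theorem nonneg_of_check {n : ℕ} (P : ℕ → Prop) [DecidablePred P]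
    (hP : ∀ a b, P a → P b → P (a ||| b)) (cert : MaskCert) (gens : List ℕ) (t : MaskTable n)
    (c : ℤ) (hgens : ∀ g ∈ gens, ∀ m, P m → P (m ||| g)) (hcheck : cert.check gens t c = true) :
    0 ≤ c + t.total (fun m => if P m then 1 else 0) := by
  have mono : ∀ g ∈ gens, ∀ m,
      (if P m then (1 : ℤ) else 0) ≤ if P (m ||| g) then 1 else 0 := by
    intro g hg m
    by_cases hm : P m
    · rw [if_pos hm, if_pos (hgens g hg m hm)]
    · rw [if_neg hm]
      split_ifs <;> norm_num
  induction cert generalizing gens t c with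
  | leaf ps =>
    have h0 := of_decide_eq_true hcheck
    have h1 := negSum_le_total (ps.foldl (push gens) t) (fun m => if P m then 1 else 0)
      (fun m => by split_ifs <;> norm_num)
      (fun m => by split_ifs <;> norm_num)
    have h2 := total_foldl_push_le gens ps t mono
    linarith
  | split ps s mem notMem ihmem ihnot =>
    simp only [check, Bool.and_eq_true, decide_eq_true_eq] at hcheck
    obtain ⟨hs, hmem, hnot⟩ := hcheck
    have h2 := total_foldl_push_le gens ps t mono
    by_cases hPs : P s
    · have hgens' : ∀ g ∈ s :: gens, ∀ m, P m → P (m ||| g) :=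
        List.forall_mem_cons.2 ⟨fun m hm => hP m s hm hPs, hgens⟩
      have h3 := ihmem _ _ _ hgens' hmem <| List.forall_mem_cons.2
        ⟨fun m => by
          by_cases hm : P m
          · rw [if_pos hm, if_pos (hP m s hm hPs)]
          · rw [if_neg hm]
            split_ifs <;> norm_num, mono⟩
      rw [total_add _ _ hs, if_pos hPs] at h3
      linarith
    · have h3 := ihnot _ _ _ hgens hnot mono
      rw [total_add _ _ hs, if_neg hPs] at h3
      linarith

end MaskCert

/-! ### From masks to sets -/

/-- The set of the entries of a list selected by a mask. -/
def maskSet : List ℕ → ℕ → Finset ℕ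
  | [], _ => ∅
  | e :: es, m => if m % 2 = 0 then maskSet es (m / 2) else insert e (maskSet es (m / 2))

theorem maskSet_or (es : List ℕ) (a b : ℕ) :
    maskSet es (a ||| b) = maskSet es a ∪ maskSet es b := by
  induction es generalizing a b with
  | nil => simp [maskSet]
  | cons e es ih =>
    have hmod : (a ||| b) % 2 = 0 ↔ a % 2 = 0 ∧ b % 2 = 0 := by
      have := Nat.or_mod_two_eq_one (a := a) (b := b)
      omega
    simp only [maskSet, Nat.or_div_two, ih, hmod]
    by_cases ha : a % 2 = 0 <;> by_cases hb : b % 2 = 0 <;> simp [ha, hb]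

/-- The sum of the weights of the elements in `X` minus the sum of the other weights. -/
def signedWeight : List (ℕ × ℤ) → Finset ℕ → ℤ
  | [], _ => 0
  | p :: L, X => (if p.1 ∈ X then p.2 else -p.2) + signedWeight L X

theorem signedWeight_congr {L : List (ℕ × ℤ)} {X Y : Finset ℕ}
    (h : ∀ p ∈ L, (p.1 ∈ X ↔ p.1 ∈ Y)) : signedWeight L X = signedWeight L Y := by
  induction L with
  | nil => rfl
  | cons p L ih =>
    rw [List.forall_mem_cons] at h
    simp only [signedWeight, h.1, ih h.2]

theorem total_ofWeights (L : List (ℕ × ℤ)) (hL : (L.map Prod.fst).Nodup) (a : ℤ)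
    (f : Finset ℕ → ℤ) :
    (MaskTable.ofWeights (L.map Prod.snd) a).total (fun m => f (maskSet (L.map Prod.fst) m)) =
      ∑ X ∈ (L.map Prod.fst).toFinset.powerset, (a + signedWeight L X) * f X := by
  induction L generalizing a f with
  | nil => 
    change a * f ∅ = _
    simp [signedWeight]
  | cons p L ih =>
    rw [List.map_cons, List.nodup_cons] at hL
    obtain ⟨hp, hL⟩ := hL
    have hp' : p.1 ∉ (L.map Prod.fst).toFinset := by rwa [List.mem_toFinset]
    have heven : ∀ m, maskSet ((p :: L).map Prod.fst) (2 * m) = maskSet (L.map Prod.fst) m := by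
      intro m
      simp [maskSet]
    have hodd : ∀ m, maskSet ((p :: L).map Prod.fst) (2 * m + 1) =
        insert p.1 (maskSet (L.map Prod.fst) m) := by
      intro m
      have : (2 * m + 1) / 2 = m := by omega
      simp [maskSet, this]
    change (MaskTable.ofWeights (L.map Prod.snd) (a - p.2)).total
        (fun m => f (maskSet ((p :: L).map Prod.fst) (2 * m))) +
      (MaskTable.ofWeights (L.map Prod.snd) (a + p.2)).total
        (fun m => f (maskSet ((p :: L).map Prod.fst) (2 * m + 1))) = _
    simp only [heven, hodd]
    rw [ih hL, List.map_cons, List.toFinset_cons, Finset.sum_powerset_insert hp']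
    have hr := ih hL (a + p.2) (fun X => f (insert p.1 X))
    congr 1
    · refine Finset.sum_congr rfl fun X hX => ?_
      have hX' : p.1 ∉ X := fun h => hp' (Finset.mem_powerset.1 hX h)
      rw [signedWeight, if_neg hX']
      ring
    · refine hr.trans (Finset.sum_congr rfl fun X hX => ?_)
      rw [signedWeight, if_pos (Finset.mem_insert_self _ _),
        signedWeight_congr (X := insert p.1 X) (Y := X)]
      · ring
      · intro q hq
        have : q.1 ≠ p.1 := fun h => hp (h ▸ List.mem_map_of_mem hq)
        simp [this]

theorem sum_signedWeight_eq (F : Finset (Finset ℕ)) (L : List (ℕ × ℤ)) :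
    ∑ S ∈ F, signedWeight L S = ∑ T ∈ F.image (· \ (L.map Prod.fst).toFinset),
      ∑ X ∈ (L.map Prod.fst).toFinset.powerset,
        signedWeight L X * if T ∪ X ∈ F then 1 else 0 := by
  set U := (L.map Prod.fst).toFinset with hU
  rw [← Finset.sum_fiberwise_of_maps_to (g := (· \ U)) fun S hS => Finset.mem_image_of_mem _ hS]
  refine Finset.sum_congr rfl fun T hT => ?_
  have hTU : Disjoint T U := by
    obtain ⟨S, -, rfl⟩ := Finset.mem_image.1 hT
    exact Finset.sdiff_disjoint
  simp only [mul_ite, mul_one, mul_zero]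
  rw [← Finset.sum_filter]
  refine Finset.sum_nbij' (· ∩ U) (T ∪ ·) ?_ ?_ ?_ ?_ ?_
  · intro S hS
    obtain ⟨hSF, rfl⟩ := Finset.mem_filter.1 hS
    simp only [Finset.mem_filter, Finset.mem_powerset, Finset.inter_subset_right, true_and,
      Finset.sdiff_union_inter, hSF]
  · intro X hX
    obtain ⟨hX, hF⟩ := Finset.mem_filter.1 hX
    rw [Finset.mem_powerset] at hX
    refine Finset.mem_filter.2 ⟨hF, ?_⟩
    rw [Finset.union_sdiff_distrib, hTU.sdiff_eq_left, Finset.sdiff_eq_empty_iff_subset.2 hX,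
      Finset.union_empty]
  · intro S hS
    obtain ⟨-, rfl⟩ := Finset.mem_filter.1 hS
    exact Finset.sdiff_union_inter S U
  · intro X hX
    rw [Finset.mem_filter, Finset.mem_powerset] at hX
    rw [Finset.union_inter_distrib_right, Finset.disjoint_iff_inter_eq_empty.1 hTU,
      Finset.empty_union, Finset.inter_eq_left.2 hX.1]
  · intro S hS
    refine signedWeight_congr fun p hp => ?_
    have : p.1 ∈ U := by
      rw [hU, List.mem_toFinset]
      exact List.mem_map_of_mem hp
    simp [this]

theorem sum_signedWeight_le (F : Finset (Finset ℕ)) (L : List (ℕ × ℤ)) (hpos : ∀ p ∈ L, 0 < p.2)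
    (hF : ∀ p ∈ L, 2 * (memFam F p.1).card < F.card) :
    ∑ S ∈ F, signedWeight L S ≤ -L.length := by
  induction L with
  | nil => simp [signedWeight]
  | cons p L ih =>
    rw [List.forall_mem_cons] at hpos hF
    have hsum : ∑ S ∈ F, (if p.1 ∈ S then p.2 else -p.2) =
        p.2 * (2 * (memFam F p.1).card - F.card) := by
      have h1 : ∀ S : Finset ℕ, (if p.1 ∈ S then p.2 else -p.2) =
          2 * p.2 * (if p.1 ∈ S then 1 else 0) - p.2 := by
        intro S
        split_ifs <;> ring
      simp only [h1, Finset.sum_sub_distrib, ← Finset.mul_sum, Finset.sum_boole,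
        Finset.sum_const, nsmul_eq_mul, memFam]
      ring
    have h2 := ih hpos.2 hF.2
    have h3 : (2 * (memFam F p.1).card : ℤ) + 1 ≤ F.card := by exact_mod_cast hF.1
    simp only [signedWeight, Finset.sum_add_distrib, hsum, List.length_cons]
    push_cast
    nlinarith [hpos.1]

theorem exists_abundant_of_cert (F : Finset (Finset ℕ)) (hUC : UC F) (hne : F.Nonempty)
    (L : List (ℕ × ℤ)) (hL0 : L ≠ []) (hL : (L.map Prod.fst).Nodup) (hpos : ∀ p ∈ L, 0 < p.2)
    (gens : List ℕ) (hgens : ∀ g ∈ gens, maskSet (L.map Prod.fst) g ∈ F) (cert : MaskCert)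
    (hcheck : cert.check gens (MaskTable.ofWeights (L.map Prod.snd) 0) 0 = true) :
    ∃ i ∈ famU F, 2 * (memFam F i).card ≥ F.card := by
  by_contra! hcon
  have hlt : ∀ p ∈ L, 2 * (memFam F p.1).card < F.card := by
    intro p _
    by_cases hp : p.1 ∈ famU F
    · exact hcon _ hp
    · have hempty : memFam F p.1 = ∅ := by
        refine Finset.filter_eq_empty_iff.2 fun S hS hpS => hp ?_
        exact Finset.mem_sup.2 ⟨S, hS, hpS⟩
      simpa [hempty] using hne
  have hle := sum_signedWeight_le F L hpos hlt
  have hge : 0 ≤ ∑ S ∈ F, signedWeight L S := by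
    rw [sum_signedWeight_eq]
    refine Finset.sum_nonneg fun T _ => ?_
    have h := MaskCert.nonneg_of_check (fun m => T ∪ maskSet (L.map Prod.fst) m ∈ F)
      (fun a b ha hb => by
        rw [maskSet_or, Finset.union_union_distrib_left]
        exact hUC _ ha _ hb)
      cert gens _ 0
      (fun g hg m hm => by
        rw [maskSet_or, ← Finset.union_assoc]
        exact hUC _ hm _ (hgens g hg)) hcheck
    rw [total_ofWeights L hL 0 fun X => if T ∪ X ∈ F then 1 else 0] at h
    simpa using h
  have : 0 < L.length := List.length_pos_iff.2 hL0
  omega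

/-! ### The five configurations -/

/-- A certificate for three sets whose traces off `x` form a triangle. -/
def triangleCert : MaskCert :=
  (.split [] 1
    (.split [(1, 7), (1, 11), (1, 13), (1, 15)] 2
      (.split [] 4
        (.leaf [(8, 14)])
        (.leaf []))
      (.leaf []))
    (.leaf [(2, 15), (4, 13), (8, 15), (0, 7), (0, 11)]))

theorem check_triangleCert :
    triangleCert.check [7, 13, 11] (MaskTable.ofWeights [1, 1, 1, 1] 0) 0 = true := by
  decide +kernel

theorem exists_abundant_of_triangle {F : Finset (Finset ℕ)} (hUC : UC F) {x a b c : ℕ}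
    (hnd : [x, a, b, c].Nodup)
    (h1 : {x, a, b} ∈ F) (h2 : {x, b, c} ∈ F) (h3 : {x, a, c} ∈ F) :
    ∃ i ∈ famU F, 2 * (memFam F i).card ≥ F.card :=
  exists_abundant_of_cert F hUC ⟨_, h1⟩
    [(x, 1), (a, 1), (b, 1), (c, 1)]
    (List.cons_ne_nil _ _) hnd (by simp) [7, 13, 11] (by simp [maskSet, h1, h2, h3])
    triangleCert check_triangleCert

/-- A certificate for three sets sharing two elements. -/
def starCert : MaskCert :=
  (.split [(0, 7)] 4
    (.split [(4, 15), (4, 23), (4, 31), (0, 11), (18, 22), (17, 21)] 24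
      (.leaf [(5, 29), (2, 26), (6, 30), (0, 19), (2, 30), (10, 14), (9, 13), (1, 25), (1, 29),
          (24, 27)])
      (.split [(2, 19)] 8
        (.split [(2, 14), (8, 27)] 20
          (.leaf [(16, 24), (1, 29)])
          (.leaf [(16, 20), (1, 13)]))
        (.split [] 12
          (.split [(1, 13), (2, 14)] 16
            (.leaf [(9, 25), (10, 26), (16, 27)])
            (.leaf [(9, 27), (10, 27)]))
          (.leaf [(9, 13), (10, 14), (16, 27)]))))
    (.split [] 8
      (.split [(6, 14), (8, 11), (8, 27), (8, 31), (0, 15)] 9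
        (.split [(20, 29)] 16
          (.leaf [(5, 21), (10, 26), (12, 13), (12, 29), (16, 19), (16, 23), (8, 25)])
          (.leaf [(18, 23), (1, 19), (2, 23), (24, 25)]))
        (.leaf [(17, 25), (2, 19), (16, 23), (5, 13), (18, 26), (1, 9)]))
      (.split [(0, 11), (0, 15), (1, 15)] 16
        (.leaf [(5, 21), (6, 22), (9, 25), (10, 26), (16, 19), (16, 23), (16, 27), (16, 31)])
        (.leaf [(5, 23), (6, 23), (9, 27), (10, 27), (12, 31), (17, 27), (18, 27), (20, 31), (24, 31),
            (1, 19), (2, 19), (2, 23)]))))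

theorem check_starCert :
    starCert.check [7, 11, 19] (MaskTable.ofWeights [3, 3, 2, 2, 2] 0) 0 = true := by
  decide +kernel

theorem exists_abundant_of_star {F : Finset (Finset ℕ)} (hUC : UC F) {x y a b c : ℕ}
    (hnd : [x, y, a, b, c].Nodup)
    (h1 : {x, y, a} ∈ F) (h2 : {x, y, b} ∈ F) (h3 : {x, y, c} ∈ F) :
    ∃ i ∈ famU F, 2 * (memFam F i).card ≥ F.card :=
  exists_abundant_of_cert F hUC ⟨_, h1⟩
    [(x, 3), (y, 3), (a, 2), (b, 2), (c, 2)]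
    (List.cons_ne_nil _ _) hnd (by simp) [7, 11, 19] (by simp [maskSet, h1, h2, h3])
    starCert check_starCert

/-- A certificate for three sets whose traces off `x` form a path. -/
def pathCert : MaskCert :=
  (.split [(0, 7)] 1
    (.split [(1, 13), (1, 25), (1, 29), (1, 31), (10, 11), (20, 21), (1, 15)] 6
      (.split [(24, 30), (2, 27)] 16
        (.leaf [(12, 28), (2, 19), (8, 14), (8, 30), (1, 23)])
        (.leaf [(18, 23)]))
      (.split [(16, 23)] 2
        (.leaf [(4, 6), (1, 27)])
        (.leaf [(18, 27)])))
    (.split [(16, 23), (16, 25)] 4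
      (.split [(2, 27), (0, 15), (17, 21), (4, 13), (4, 29), (4, 31)] 8
        (.leaf [(20, 28), (3, 11), (18, 30), (2, 14), (8, 25)])
        (.leaf [(10, 14), (24, 25), (24, 28)]))
      (.split [] 8
        (.leaf [(3, 11), (0, 15), (2, 27), (6, 14), (20, 28), (8, 13), (8, 25), (8, 29), (8, 31)])
        (.leaf [(3, 27), (6, 31), (12, 29), (17, 25), (18, 31), (20, 29), (24, 29), (0, 13), (0, 15),
            (2, 15), (2, 27), (10, 31)]))))

theorem check_pathCert :
    pathCert.check [7, 13, 25] (MaskTable.ofWeights [4, 2, 3, 3, 2] 0) 0 = true := by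
  decide +kernel

theorem exists_abundant_of_path {F : Finset (Finset ℕ)} (hUC : UC F) {x a b c d : ℕ}
    (hnd : [x, a, b, c, d].Nodup)
    (h1 : {x, a, b} ∈ F) (h2 : {x, b, c} ∈ F) (h3 : {x, c, d} ∈ F) :
    ∃ i ∈ famU F, 2 * (memFam F i).card ≥ F.card :=
  exists_abundant_of_cert F hUC ⟨_, h1⟩
    [(x, 4), (a, 2), (b, 3), (c, 3), (d, 2)]
    (List.cons_ne_nil _ _) hnd (by simp) [7, 13, 25] (by simp [maskSet, h1, h2, h3])
    pathCert check_pathCert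

/-- A certificate for three sets whose traces off `x` form a cherry and a disjoint edge. -/
def cherryCert : MaskCert :=
  (.split [(16, 23), (0, 7), (5, 53), (0, 49)] 4
    (.split [(32, 39), (4, 13), (4, 15), (4, 55), (4, 61), (4, 63), (4, 53), (38, 47), (28, 31),
        (10, 59), (44, 47), (22, 31)] 40
      (.split [(4, 45), (4, 47), (40, 57), (34, 51), (33, 37), (3, 43)] 2
        (.split [(18, 31), (50, 62), (48, 54), (4, 46), (40, 59)] 1
          (.leaf [(17, 29), (52, 62), (56, 62), (8, 11), (16, 19), (16, 21), (20, 29), (20, 31),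
              (24, 25), (24, 27), (24, 30), (26, 30), (26, 31), (32, 35), (48, 58), (48, 60),
              (40, 41), (40, 43)])
          (.leaf [(24, 30), (9, 11), (24, 31), (17, 21), (20, 29), (26, 58), (9, 41), (56, 60),
              (16, 29), (9, 43), (48, 62)]))
        (.leaf [(1, 41), (48, 60), (24, 31), (16, 29), (6, 46), (18, 62), (50, 54), (42, 59), (26, 30),
            (20, 29), (17, 21), (20, 31)]))
      (.split [(42, 46), (17, 21), (34, 47), (36, 47)] 24
        (.split [(36, 45), (4, 29), (4, 31), (24, 57), (3, 27)] 2
          (.split [(4, 30), (2, 51), (24, 59)] 1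
            (.leaf [(33, 45), (50, 62), (52, 62), (56, 62), (8, 11), (16, 19), (32, 35), (32, 37),
                (48, 54), (48, 58), (48, 60), (24, 25), (24, 27)])
            (.leaf [(52, 60), (9, 11), (9, 25), (9, 27), (32, 45), (33, 37), (48, 62)]))
          (.leaf [(33, 37), (50, 54), (1, 25), (6, 30), (18, 51), (26, 59), (32, 45), (56, 60)]))
        (.split [(16, 29), (20, 29), (20, 31), (32, 45), (33, 37), (36, 45), (26, 30), (18, 31)] 2
          (.split [(9, 11), (48, 54), (56, 58)] 12
            (.leaf [(50, 62), (52, 60), (8, 57), (9, 59), (48, 62), (56, 60), (2, 51)])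
            (.leaf [(8, 12), (0, 51), (56, 57)]))
          (.split [(8, 57)] 48
            (.leaf [(14, 62), (6, 54), (8, 60), (50, 51)])
            (.leaf [(50, 54)])))))
    (.split [] 24
      (.split [(24, 31), (24, 57), (24, 61), (24, 63), (24, 29), (0, 13), (18, 51), (26, 59), (44, 60),
          (0, 15), (3, 27), (16, 55), (10, 59)] 34
        (.split [(14, 62), (22, 54), (28, 62), (38, 62), (6, 30), (6, 62), (12, 46), (12, 62), (32, 45),
            (34, 39), (34, 47), (34, 55), (24, 58)] 1
          (.leaf [(52, 53), (2, 27), (8, 43), (10, 11), (18, 19), (20, 21), (20, 53), (36, 37),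
              (36, 53), (40, 41), (24, 25), (34, 35)])
          (.leaf [(36, 60), (52, 54), (33, 35), (9, 43), (36, 53), (20, 53)]))
        (.split [(52, 53), (40, 47), (38, 47), (33, 45), (32, 45)] 28
          (.split [(48, 60), (1, 25), (20, 53), (50, 62)] 2
            (.leaf [(9, 11), (1, 27), (42, 47), (36, 39), (48, 62), (17, 19), (32, 34), (24, 30),
                (2, 55)])
            (.leaf [(36, 47), (6, 30), (32, 39), (42, 62), (48, 55)]))
          (.split [(12, 28), (20, 28), (32, 39)] 1
            (.split [(42, 43), (2, 27), (10, 11), (18, 19), (36, 47), (24, 25), (1, 55)] 6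
              (.leaf [(48, 54), (50, 62), (24, 30)])
              (.leaf [(14, 30), (22, 30), (36, 37), (50, 58)]))
            (.leaf [(17, 55), (6, 30), (6, 55), (9, 25), (18, 55), (36, 53), (42, 47)]))))
      (.split [(52, 53), (2, 51)] 8
        (.split [(20, 29), (26, 31), (28, 31), (36, 53), (3, 11), (16, 24), (17, 25), (17, 29), (8, 13),
            (8, 15), (8, 57), (8, 61), (8, 63), (22, 30), (33, 41), (38, 46), (40, 47), (42, 47),
            (50, 58), (18, 31), (33, 45)] 56
          (.split [(14, 62)] 34
            (.leaf [(44, 62), (1, 35), (3, 43), (6, 46), (6, 62), (9, 43), (12, 60), (12, 62),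
                (32, 45), (34, 39), (8, 47), (34, 55), (8, 59)])
            (.split [(1, 55), (6, 62), (2, 55), (3, 59), (32, 39), (32, 45)] 12
              (.leaf [(44, 45), (2, 59), (10, 59), (10, 62), (8, 60)])
              (.leaf [(44, 60), (10, 59)])))
          (.split [(48, 56), (32, 39), (32, 45)] 42
            (.leaf [(0, 47), (34, 55), (6, 46), (6, 55), (3, 55), (1, 43), (8, 59)])
            (.leaf [(1, 55), (34, 42), (44, 45), (2, 55), (3, 59), (10, 59)])))
        (.split [(17, 29), (18, 31), (0, 13), (0, 15), (16, 29), (32, 39), (10, 59), (9, 57), (33, 45),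
            (56, 57)] 40
          (.split [(3, 43), (36, 53), (1, 41), (6, 46), (20, 31), (20, 53), (32, 55), (34, 55),
              (40, 45), (40, 47), (40, 61), (40, 63)] 58
            (.leaf [(38, 62), (12, 62), (40, 59)])
            (.leaf [(26, 58), (50, 58), (42, 59)]))
          (.split [(34, 47), (26, 59), (32, 45)] 48
            (.leaf [(14, 62), (22, 31), (28, 31), (6, 54), (12, 60), (26, 31), (20, 53), (36, 47),
                (36, 53), (48, 55), (48, 61), (48, 63)])
            (.leaf [(3, 63), (6, 63), (12, 61), (14, 63), (22, 63), (28, 61), (38, 63), (42, 47),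
                (44, 61), (50, 55), (0, 61), (20, 31), (20, 53), (26, 63), (2, 63), (2, 55),
                (1, 55), (1, 61), (36, 53), (56, 61)]))))))

theorem check_cherryCert :
    cherryCert.check [7, 13, 49] (MaskTable.ofWeights [10, 5, 8, 5, 5, 5] 0) 0 = true := by
  decide +kernel

theorem exists_abundant_of_cherry {F : Finset (Finset ℕ)} (hUC : UC F) {x a b c d e : ℕ}
    (hnd : [x, a, b, c, d, e].Nodup)
    (h1 : {x, a, b} ∈ F) (h2 : {x, b, c} ∈ F) (h3 : {x, d, e} ∈ F) :
    ∃ i ∈ famU F, 2 * (memFam F i).card ≥ F.card :=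
  exists_abundant_of_cert F hUC ⟨_, h1⟩
    [(x, 10), (a, 5), (b, 8), (c, 5), (d, 5), (e, 5)]
    (List.cons_ne_nil _ _) hnd (by simp) [7, 13, 49] (by simp [maskSet, h1, h2, h3])
    cherryCert check_cherryCert

/-- A certificate for three sets pairwise meeting only in `x`. -/
def sunflowerCert : MaskCert :=
  (.split [(8, 15), (0, 31)] 1
    (.split [(9, 111), (10, 107), (12, 109), (17, 119), (40, 47), (42, 43), (44, 45), (48, 55),
        (50, 51), (52, 53), (65, 95), (66, 91), (68, 93), (72, 79), (74, 75), (76, 77), (80, 87),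
        (82, 83), (84, 85), (4, 29), (8, 105), (32, 39), (64, 71), (64, 89), (1, 103), (1, 121),
        (1, 127), (3, 123), (33, 63), (2, 27), (4, 101), (16, 23), (16, 113), (32, 57), (18, 115)] 6
      (.split [(5, 125), (14, 111), (20, 117), (22, 119), (34, 59), (36, 61), (38, 63), (70, 95),
          (104, 110), (112, 118), (2, 99), (2, 123), (4, 125), (8, 111), (16, 119)] 24
        (.leaf [(26, 123), (28, 125), (56, 63), (88, 95), (96, 126), (98, 122), (100, 124), (32, 62),
            (64, 94)])
        (.split [] 30
          (.leaf [(26, 123), (28, 125), (56, 63), (88, 95), (98, 126), (100, 126), (32, 62), (64, 94)])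
          (.leaf [(26, 30), (28, 30), (56, 62), (88, 94), (98, 123), (100, 125), (32, 63), (64, 95)])))
      (.split [(64, 95), (32, 63), (104, 111)] 96
        (.split [(5, 125), (20, 117), (26, 122), (28, 124), (34, 59), (36, 61), (98, 123), (100, 125),
            (112, 119), (2, 99), (2, 123), (4, 125)] 102
          (.leaf [(14, 111), (22, 119), (38, 63), (56, 126), (70, 95), (88, 126), (8, 110), (16, 118)])
          (.leaf [(14, 110), (22, 118), (38, 102), (56, 63), (70, 102), (88, 95), (8, 111), (16, 119)]))
        (.split [(8, 111), (16, 119), (22, 119), (26, 123)] 24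
          (.leaf [(5, 125), (20, 117), (28, 125), (34, 59), (36, 61), (38, 62), (56, 63), (70, 94),
              (88, 95), (98, 122), (100, 124), (2, 99), (2, 123), (4, 125)])
          (.split [(70, 95), (38, 63)] 56
            (.leaf [(14, 62), (20, 117), (28, 125), (98, 122), (100, 124), (2, 59), (4, 61), (34, 99),
                (34, 123), (36, 125)])
            (.split [(34, 59), (36, 61), (2, 99)] 112
              (.leaf [(5, 117), (20, 125), (28, 124), (98, 123), (100, 125), (4, 117)])
              (.leaf [(5, 125), (20, 117), (28, 125), (2, 123), (4, 125)]))))))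
    (.split [] 40
      (.split [(32, 39), (40, 57), (40, 105), (40, 111), (40, 121), (40, 127), (3, 43), (5, 45),
          (40, 47), (40, 63), (34, 99), (64, 71), (4, 29), (0, 103)] 46
        (.split [(2, 27), (52, 117), (36, 101)] 20
          (.split [(10, 59), (33, 53), (32, 55), (20, 23), (40, 61), (40, 62), (20, 117), (20, 119),
              (40, 125), (65, 85), (48, 113), (18, 115), (42, 107), (26, 123)] 68
            (.split [(12, 79), (14, 94), (64, 89), (20, 87), (20, 93), (20, 95), (40, 109), (40, 110),
                (40, 124), (40, 126)] 66
              (.leaf [(9, 75), (17, 83), (112, 122), (96, 118), (66, 91), (40, 107), (40, 123)])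
              (.leaf [(98, 107), (74, 91), (9, 77), (82, 91), (34, 118), (2, 123)]))
            (.leaf [(12, 109), (50, 123), (66, 91), (70, 95), (72, 79), (74, 94), (76, 93), (82, 122),
                (84, 95), (88, 95), (98, 118), (100, 126), (104, 124), (2, 107), (2, 123), (64, 87),
                (80, 89), (80, 93), (96, 110), (96, 126)]))
          (.split [(84, 117), (48, 55), (17, 119), (16, 23)] 24
            (.split [(12, 109), (28, 125), (44, 125), (66, 91), (68, 93), (70, 94), (72, 79), (74, 95),
                (4, 61), (16, 113), (36, 125), (40, 62), (50, 115), (26, 123), (34, 123)] 18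
              (.leaf [(33, 51), (65, 83), (76, 124), (82, 122), (88, 95), (98, 126), (100, 118),
                  (104, 126), (10, 107), (64, 87), (80, 89), (80, 95), (96, 110), (40, 59),
                  (18, 115), (18, 119), (40, 123)])
              (.split [(82, 115), (100, 124), (98, 122)] 22
                (.leaf [(88, 126), (42, 107), (65, 89), (96, 118), (80, 126), (64, 87), (10, 107),
                    (96, 110), (2, 123), (80, 95), (2, 59), (10, 59), (76, 95), (22, 119)])
                (.leaf [(10, 107), (42, 123), (65, 95), (76, 110), (80, 87), (96, 126), (112, 119),
                    (2, 59), (16, 119), (64, 89), (64, 95)])))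
            (.split [(98, 123), (34, 107), (100, 125), (70, 95), (96, 110)] 72
              (.split [(22, 94), (42, 107), (50, 115), (56, 126), (74, 123), (80, 87), (82, 115),
                  (88, 126), (112, 113), (18, 119), (72, 79), (72, 89), (72, 95)] 4
                (.leaf [(16, 20), (26, 91), (28, 124), (65, 77), (2, 123), (2, 59), (10, 59), (10, 91),
                    (40, 61), (72, 93), (40, 109), (40, 125)])
                (.leaf [(12, 61), (26, 122), (28, 93), (44, 109), (66, 123), (76, 125), (2, 59),
                    (10, 91), (16, 62), (36, 109), (68, 93), (68, 125)]))
              (.split [(12, 109), (18, 115), (26, 123), (28, 125), (44, 125), (66, 91), (68, 93),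
                  (74, 79), (76, 79), (82, 122), (112, 126), (2, 59), (4, 61), (10, 107), (16, 113)] 22
                (.leaf [(50, 123), (65, 89), (80, 95), (88, 94), (104, 126), (64, 87), (40, 62),
                    (22, 119)])
                (.leaf [(42, 123), (50, 119), (56, 62), (65, 95), (80, 87), (88, 126), (16, 119),
                    (64, 89), (64, 95)])))))
        (.split [(48, 55), (16, 23), (22, 62), (64, 89), (14, 46), (38, 46), (6, 46), (70, 110),
            (112, 119), (42, 107), (10, 59), (34, 107)] 2
          (.split [(4, 46), (16, 119), (52, 117), (12, 46), (84, 117), (44, 46), (28, 125), (100, 101),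
              (36, 46), (20, 61), (68, 93), (76, 109), (2, 27), (40, 123)] 67
            (.leaf [(72, 75), (74, 79), (72, 79), (50, 115), (80, 115), (18, 87), (80, 113), (17, 83),
                (2, 91), (2, 95)])
            (.leaf [(18, 115), (88, 122), (72, 79), (64, 91), (82, 95), (74, 95), (80, 87), (66, 95),
                (66, 91), (17, 113), (65, 67)]))
          (.split [(66, 91), (72, 79), (4, 61), (74, 123)] 68
            (.leaf [(18, 123), (82, 115), (80, 113), (16, 87), (9, 77), (50, 115), (28, 124),
                (52, 117), (17, 85), (20, 119), (80, 117), (26, 94), (68, 93), (68, 95), (68, 101),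
                (40, 109), (40, 125)])
            (.leaf [(17, 119), (18, 115), (20, 117), (26, 27), (28, 125), (50, 123), (52, 125),
                (65, 95), (76, 93), (80, 87), (82, 122), (84, 93), (88, 95), (98, 123), (100, 125),
                (12, 109), (16, 113), (16, 119), (36, 101), (64, 95)]))))
      (.split [(2, 27), (4, 29), (33, 39), (0, 103)] 32
        (.split [(9, 47), (42, 107), (104, 105), (4, 61), (8, 40), (10, 47), (34, 99), (36, 101),
            (32, 57), (32, 63), (32, 121), (32, 127)] 96
          (.split [(72, 79), (98, 123), (100, 125), (64, 71), (28, 124), (50, 115), (14, 110), (65, 89),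
              (17, 23), (48, 113), (48, 119)] 56
            (.split [(6, 62), (6, 126)] 16
              (.split [(3, 51), (5, 53), (44, 109), (84, 125), (64, 87), (32, 55), (32, 119)] 88
                (.leaf [(12, 111), (20, 93), (22, 94), (26, 91), (38, 118), (52, 117), (70, 126),
                    (74, 107), (76, 109), (82, 122), (2, 123), (10, 111), (18, 91), (18, 59),
                    (34, 59), (36, 117), (66, 115), (68, 125), (16, 95)])
                (.leaf [(20, 117), (22, 118), (26, 122), (38, 126), (52, 125), (66, 91), (68, 93),
                    (70, 95), (74, 111), (76, 111), (80, 95), (82, 123), (2, 123), (2, 59),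
                    (10, 107), (12, 109), (12, 111), (18, 59), (18, 115)]))
              (.leaf [(3, 123), (5, 125), (12, 109), (18, 55), (20, 117), (22, 118), (26, 122),
                  (38, 126), (44, 111), (52, 119), (66, 91), (68, 93), (70, 95), (74, 111),
                  (76, 111), (80, 87), (82, 115), (84, 119), (2, 59), (10, 107), (34, 123),
                  (36, 125), (64, 95)]))
            (.split [(20, 117), (22, 118), (24, 56), (26, 122), (66, 91), (68, 93), (74, 111),
                (10, 107), (70, 95), (76, 111)] 16
              (.split [(3, 51), (5, 53), (44, 109), (52, 125), (82, 123), (84, 125), (2, 123), (2, 59),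
                  (12, 111), (18, 59), (18, 115), (64, 87), (80, 95), (32, 55), (32, 119)] 120
                (.leaf [(6, 126)])
                (.leaf [(88, 120), (12, 109)]))
              (.leaf [(3, 123), (5, 125), (12, 109), (18, 55), (44, 111), (52, 119), (80, 87),
                  (82, 115), (84, 119), (2, 59), (34, 123), (36, 125), (64, 95)])))
          (.split [(12, 109), (14, 111), (18, 115), (20, 117), (44, 111), (50, 123), (52, 125),
              (65, 95), (68, 93), (70, 95), (74, 111), (2, 59), (10, 107), (16, 23), (16, 55),
              (3, 123), (17, 113), (48, 119), (64, 96), (88, 89), (36, 125)] 56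
            (.split [(22, 119), (6, 62)] 120
              (.leaf [(26, 122), (28, 124), (38, 126), (72, 79), (76, 125), (80, 87), (82, 91),
                  (84, 95), (98, 123), (6, 126), (66, 71), (66, 91)])
              (.leaf [(26, 123), (28, 125), (66, 91), (76, 79), (80, 120), (82, 87), (84, 87),
                  (98, 122), (100, 124), (112, 120), (72, 120)]))
            (.split [(24, 56), (66, 91), (72, 79)] 112
              (.leaf [(22, 118), (26, 122), (28, 124), (80, 87), (82, 95), (84, 125), (98, 123),
                  (32, 119)])
              (.leaf [(22, 119), (28, 125), (76, 95), (80, 112), (82, 87), (84, 87), (34, 123)]))))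
        (.split [(50, 63), (34, 59), (36, 61), (42, 47), (52, 63), (56, 57), (44, 47), (48, 55),
            (16, 23), (12, 109), (38, 63), (64, 71), (64, 89), (65, 95), (64, 95)] 96
          (.split [(10, 107), (18, 115), (20, 117), (96, 121), (96, 127), (98, 123), (104, 111),
              (14, 110)] 120
            (.split [(68, 93), (4, 101), (5, 125), (84, 119), (3, 123), (26, 123), (2, 99), (2, 122)] 66
              (.leaf [(72, 105), (16, 87), (6, 126), (17, 83), (80, 113), (22, 118), (4, 125),
                  (72, 111), (100, 124), (9, 75), (8, 79), (76, 125), (82, 119), (74, 111),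
                  (80, 119), (28, 94), (66, 91), (66, 95)])
              (.split [(9, 111), (17, 119), (28, 125), (72, 79), (74, 91), (76, 111), (80, 87),
                  (82, 91), (100, 125), (4, 124), (8, 105), (16, 113)] 6
                (.leaf [(22, 119), (70, 95), (88, 94), (16, 118), (96, 126)])
                (.leaf [(22, 118), (70, 126), (88, 95), (16, 119)])))
            (.split [(22, 118), (24, 120), (26, 122), (28, 124), (72, 79), (74, 111), (88, 120)] 80
              (.leaf [(3, 83), (5, 85), (9, 105), (76, 111), (82, 123), (84, 125), (100, 125), (2, 91),
                  (4, 93), (66, 99), (66, 123), (68, 101), (68, 125), (80, 87), (80, 95), (96, 113),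
                  (96, 119)])
              (.leaf [(3, 123), (5, 125), (17, 119), (66, 91), (68, 93), (70, 95), (76, 125), (82, 87),
                  (84, 87), (112, 119), (2, 99), (2, 123), (4, 101), (4, 125), (8, 105), (8, 111),
                  (16, 113), (16, 119)])))
          (.split [(9, 111), (8, 105), (17, 119), (16, 113), (16, 119)] 80
            (.split [(4, 93), (28, 125), (20, 117), (68, 101), (26, 123), (18, 115), (84, 125),
                (66, 99), (80, 87), (80, 95), (80, 119), (80, 121), (80, 127), (3, 83), (5, 85),
                (82, 123), (8, 111), (68, 125)] 86
              (.split [(98, 118), (104, 126)] 72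
                (.leaf [(2, 123), (74, 107), (66, 107), (100, 124), (112, 126), (10, 91), (72, 79),
                    (80, 94), (72, 111)])
                (.leaf [(10, 107), (14, 111), (74, 79), (76, 79), (2, 91), (24, 94), (66, 123)]))
              (.leaf [(2, 91), (70, 86), (76, 111), (72, 79), (14, 94), (66, 123), (22, 86), (10, 107),
                  (6, 86)]))
            (.split [(10, 107), (82, 87), (84, 87)] 72
              (.split [(3, 75), (5, 77), (18, 115), (20, 117), (26, 123), (28, 125), (2, 91), (4, 93),
                  (66, 99), (68, 101), (72, 79), (72, 111), (72, 121), (72, 127)] 78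
                (.leaf [(22, 119), (74, 123), (76, 125), (98, 110), (112, 126), (24, 94), (66, 123),
                    (68, 125), (72, 95)])
                (.leaf [(6, 78), (14, 78), (22, 94), (70, 78), (98, 123), (100, 125), (112, 119),
                    (8, 95)]))
              (.split [(14, 111), (66, 91), (68, 93), (74, 79), (76, 79), (2, 99), (4, 101), (8, 111),
                  (3, 123), (5, 125), (18, 115), (20, 117), (22, 119), (26, 123), (28, 125),
                  (2, 123), (4, 125)] 24
                (.leaf [(70, 94), (88, 95), (98, 122), (100, 124), (24, 121), (24, 127)])
                (.split [(70, 95)] 112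
                  (.leaf [(6, 118), (112, 121), (112, 127)])
                  (.leaf [(6, 127), (88, 121), (98, 127), (100, 127), (104, 121)])))))))))

theorem check_sunflowerCert :
    sunflowerCert.check [7, 25, 97] (MaskTable.ofWeights [2, 1, 1, 1, 1, 1, 1] 0) 0 = true := by
  decide +kernel

theorem exists_abundant_of_sunflower {F : Finset (Finset ℕ)} (hUC : UC F) {x a b c d e f : ℕ}
    (hnd : [x, a, b, c, d, e, f].Nodup)
    (h1 : {x, a, b} ∈ F) (h2 : {x, c, d} ∈ F) (h3 : {x, e, f} ∈ F) :
    ∃ i ∈ famU F, 2 * (memFam F i).card ≥ F.card :=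
  exists_abundant_of_cert F hUC ⟨_, h1⟩
    [(x, 2), (a, 1), (b, 1), (c, 1), (d, 1), (e, 1), (f, 1)]
    (List.cons_ne_nil _ _) hnd (by simp) [7, 25, 97] (by simp [maskSet, h1, h2, h3])
    sunflowerCert check_sunflowerCert

/-! ### Classification of three 3-sets with a common element -/

theorem exists_abundant_of_cherry_of_triple {F : Finset (Finset ℕ)} (hUC : UC F) {x a b c d e : ℕ}
    (hnd : [x, a, b, c].Nodup) (hde : [x, d, e].Nodup) (h1 : {x, a, b} ∈ F) (h2 : {x, b, c} ∈ F)
    (h3 : {x, d, e} ∈ F) (h13 : ({x, d, e} : Finset ℕ) ≠ {x, a, b})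
    (h23 : ({x, d, e} : Finset ℕ) ≠ {x, b, c}) :
    ∃ i ∈ famU F, 2 * (memFam F i).card ≥ F.card := by
  have swap : ∀ u v : ℕ, ({x, u, v} : Finset ℕ) = {x, v, u} := fun u v => by
    rw [Finset.pair_comm]
  have meet_once : ∀ u v, u ∈ [a, b, c] → v ∉ [x, a, b, c] → {x, u, v} ∈ F →
      ∃ i ∈ famU F, 2 * (memFam F i).card ≥ F.card := by
    intro u v hu hv h
    simp only [List.mem_cons, List.not_mem_nil, or_false] at hu
    rcases hu with rfl | rfl | rfl
    · exact exists_abundant_of_path hUC (x := x) (a := v) (b := u) (c := b) (d := c)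
        (by grind) (swap u v ▸ h) h1 h2
    · exact exists_abundant_of_star hUC (x := x) (y := u) (a := a) (b := c) (c := v)
        (by grind) (swap a u ▸ h1) h2 h
    · exact exists_abundant_of_path hUC (x := x) (a := a) (b := b) (c := u) (d := v)
        (by grind) h1 h2 h
  by_cases hd : d ∈ [a, b, c] <;> by_cases he : e ∈ [a, b, c]
  · have hac : ({x, d, e} : Finset ℕ) = {x, a, c} := by
      simp only [List.mem_cons, List.not_mem_nil, or_false] at hd he
      rcases hd with rfl | rfl | rfl <;> rcases he with rfl | rfl | rfl <;>
        first
          | rfl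
          | exact swap _ _
          | exact absurd rfl h13
          | exact absurd rfl h23
          | exact absurd (swap _ _) h13
          | exact absurd (swap _ _) h23
          | simp at hde
    exact exists_abundant_of_triangle hUC hnd h1 h2 (hac ▸ h3)
  · exact meet_once d e hd (by grind) h3
  · exact meet_once e d he (by grind) (swap d e ▸ h3)
  · exact exists_abundant_of_cherry hUC (x := x) (a := a) (b := b) (c := c) (d := d) (e := e)
      (by grind) h1 h2 h3

theorem exists_eq_triple {A : Finset ℕ} (hA : A.card = 3) {x : ℕ} (hx : x ∈ A) :
    ∃ a b, [x, a, b].Nodup ∧ A = {x, a, b} := by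
  obtain ⟨a, b, hab, h⟩ := Finset.card_eq_two.1 (by rw [Finset.card_erase_of_mem hx, hA] :
    (A.erase x).card = 2)
  have ha : a ∈ A.erase x := by simp [h]
  have hb : b ∈ A.erase x := by simp [h]
  refine ⟨a, b, ?_, by rw [← h, Finset.insert_erase hx]⟩
  grind

theorem exists_abundant_of_meeting_triples {F : Finset (Finset ℕ)} (hUC : UC F)
    {A B C : Finset ℕ} (hA : A ∈ F) (hB : B ∈ F) (hC : C ∈ F) (hAB : A ≠ B) (hAC : A ≠ C)
    (hBC : B ≠ C) (hA3 : A.card = 3) (hB3 : B.card = 3) (hC3 : C.card = 3) {x y : ℕ}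
    (hxA : x ∈ A) (hxB : x ∈ B) (hxC : x ∈ C) (hyx : y ≠ x) (hyA : y ∈ A) (hyB : y ∈ B) :
    ∃ i ∈ famU F, 2 * (memFam F i).card ≥ F.card := by
  have third : ∀ S : Finset ℕ, S.card = 3 → x ∈ S → y ∈ S →
      ∃ a, [x, a, y].Nodup ∧ S = {x, a, y} := by
    intro S hS hx hy
    obtain ⟨a, b, hnd, rfl⟩ := exists_eq_triple hS hx
    simp only [Finset.mem_insert, Finset.mem_singleton] at hy
    rcases hy with rfl | rfl | rfl
    · exact absurd rfl hyx
    · exact ⟨b, by grind, by rw [Finset.pair_comm]⟩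
    · exact ⟨a, hnd, rfl⟩
  obtain ⟨a, ha, rfl⟩ := third A hA3 hxA hyA
  obtain ⟨c, hc, rfl⟩ := third B hB3 hxB hyB
  obtain ⟨d, e, hde, rfl⟩ := exists_eq_triple hC3 hxC
  have hac : a ≠ c := fun h => hAB (by rw [h])
  rw [Finset.pair_comm c y] at hB hBC
  exact exists_abundant_of_cherry_of_triple hUC (by grind) hde hA hB hC hAC.symm hBC.symm

theorem frankl_of_three_3sets_common_element (F : Finset (Finset ℕ)) (hUC : UC F)
    (A B C : Finset ℕ) (hA : A ∈ F) (hB : B ∈ F) (hC : C ∈ F)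
    (hAB : A ≠ B) (hAC : A ≠ C) (hBC : B ≠ C)
    (hA3 : A.card = 3) (hB3 : B.card = 3) (hC3 : C.card = 3)
    (x : ℕ) (hxA : x ∈ A) (hxB : x ∈ B) (hxC : x ∈ C) :
    ∃ i ∈ famU F, 2 * (memFam F i).card ≥ F.card := by
  by_cases h₁ : ∃ y, y ≠ x ∧ y ∈ A ∧ y ∈ B
  · obtain ⟨y, hyx, hyA, hyB⟩ := h₁
    exact exists_abundant_of_meeting_triples hUC hA hB hC hAB hAC hBC hA3 hB3 hC3 hxA hxB hxC
      hyx hyA hyB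
  by_cases h₂ : ∃ y, y ≠ x ∧ y ∈ A ∧ y ∈ C
  · obtain ⟨y, hyx, hyA, hyC⟩ := h₂
    exact exists_abundant_of_meeting_triples hUC hA hC hB hAC hAB hBC.symm hA3 hC3 hB3 hxA hxC hxB
      hyx hyA hyC
  by_cases h₃ : ∃ y, y ≠ x ∧ y ∈ B ∧ y ∈ C
  · obtain ⟨y, hyx, hyB, hyC⟩ := h₃
    exact exists_abundant_of_meeting_triples hUC hB hC hA hBC hAB.symm hAC.symm hB3 hC3 hA3 hxB hxC
      hxA hyx hyB hyC
  obtain ⟨a, b, hab, rfl⟩ := exists_eq_triple hA3 hxA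
  obtain ⟨c, d, hcd, rfl⟩ := exists_eq_triple hB3 hxB
  obtain ⟨e, f, hef, rfl⟩ := exists_eq_triple hC3 hxC
  push Not at h₁ h₂ h₃
  refine exists_abundant_of_sunflower hUC (x := x) (a := a) (b := b) (c := c) (d := d) (e := e)
    (f := f) ?_ hA hB hC
  have ha₁ := h₁ a
  have hb₁ := h₁ b
  have ha₂ := h₂ a
  have hb₂ := h₂ b
  have hc₃ := h₃ c
  have hd₃ := h₃ d
  simp only [Finset.mem_insert, Finset.mem_singleton] at ha₁ hb₁ ha₂ hb₂ hc₃ hd₃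
  grind
end
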